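/- arXiv:1908.08245 — 3 statements merged into one kernel-verified Lean document; each statement's English description precedes it below -/
import Mathlib

section
/- Suppose Assumptions (A2.b), (A3.a) and (A3.c) hold, and that there exist a positive integer h and a constant θ > 0 such that inf_{m≥0} λ′_m^h ≥ θ almost surely. Then lim_{k→∞} ‖ E[ Φ_F(k,0) Φ_F(k,0)ᵀ ] ‖ = 0. -/
open MeasureTheory Filter Matrix Topology
open scoped Kronecker

/-- Spectral (2-)norm of a real matrix. -/
noncomputable def specNorm {p q : Type*} [Fintype p] [Fintype q] [DecidableEq q]
    (A : Matrix p q ℝ) : ℝ :=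
  ‖LinearMap.toContinuousLinearMap (Matrix.toEuclideanLin A)‖

/-- Smallest eigenvalue of a (symmetric) real matrix, as the infimum of the Rayleigh
quotient over the unit sphere. -/
noncomputable def lambdaMin {p : Type*} [Fintype p] (A : Matrix p p ℝ) : ℝ :=
  ⨅ x : {x : p → ℝ // ∑ i, x i ^ 2 = 1}, dotProduct x.1 (A.mulVec x.1)

/-- Entrywise conditional expectation of a random matrix. -/
noncomputable def cexpM {Ω : Type*} [MeasurableSpace Ω] (μ : Measure Ω)
    (m : MeasurableSpace Ω) {p q : Type*} (M : Ω → Matrix p q ℝ) (ω : Ω) :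
    Matrix p q ℝ :=
  Matrix.of fun i j => (μ[(fun ω' => M ω' i j)|m]) ω

/-- Entrywise expectation of a random matrix. -/
noncomputable def expM {Ω : Type*} [MeasurableSpace Ω] (μ : Measure Ω)
    {p q : Type*} (M : Ω → Matrix p q ℝ) : Matrix p q ℝ :=
  Matrix.of fun i j => ∫ ω, M ω i j ∂μ

/-- Degree matrix of a weighted adjacency matrix. -/
def degMat {N : ℕ} (A : Matrix (Fin N) (Fin N) ℝ) : Matrix (Fin N) (Fin N) ℝ :=
  Matrix.diagonal (fun i => ∑ j, A i j)

/-- Laplacian matrix of a weighted adjacency matrix. -/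
def lapl {N : ℕ} (A : Matrix (Fin N) (Fin N) ℝ) : Matrix (Fin N) (Fin N) ℝ :=
  degMat A - A

/-- Symmetrized Laplacian `(ℒ + ℒᵀ)/2`. -/
noncomputable def symmLapl {N : ℕ} (A : Matrix (Fin N) (Fin N) ℝ) :
    Matrix (Fin N) (Fin N) ℝ :=
  (2:ℝ)⁻¹ • (lapl A + (lapl A)ᵀ)

/-- The `Nn × Nn` matrix `ℋᵀℋ`, where `ℋ = blockdiag(H_1, …, H_N)`. -/
def blockHtH {N n : ℕ} {ni : Fin N → ℕ}
    (H : ∀ i : Fin N, Matrix (Fin (ni i)) (Fin n) ℝ) :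
    Matrix (Fin N × Fin n) (Fin N × Fin n) ℝ :=
  Matrix.of fun p q => if p.1 = q.1 then ((H p.1)ᵀ * H p.1) p.2 q.2 else 0

/-- Delay matrix `𝕀(k,q)`: entry `(i,j)` is `1` if `λ_{ji}(k) = q` and `0` otherwise. -/
def delayMat {N : ℕ} (lam : Fin N → Fin N → ℕ) (q : ℕ) : Matrix (Fin N) (Fin N) ℝ :=
  Matrix.of fun i j => if lam j i = q then 1 else 0

/-- The delay-weighted adjacency matrix `Ā(k,q) = (𝒜(k) ∘ 𝕀(k,q)) ⊗ I_n`. -/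
def delayAdj {N : ℕ} (n : ℕ) (A : Matrix (Fin N) (Fin N) ℝ)
    (lam : Fin N → Fin N → ℕ) (q : ℕ) :
    Matrix (Fin N × Fin n) (Fin N × Fin n) ℝ :=
  (Matrix.hadamard A (delayMat lam q)) ⊗ₖ (1 : Matrix (Fin n) (Fin n) ℝ)

/-- The backward matrix product `Φ_F(j,i) = F(j)F(j−1)⋯F(i)` for `j ≥ i`, and `I` for
`j < i`, for a family of square matrices indexed by `ℤ`. -/
noncomputable def phiProdZ {p : Type*} [Fintype p] [DecidableEq p]
    (F : ℤ → Matrix p p ℝ) (j i : ℤ) : Matrix p p ℝ :=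
  if i ≤ j then ((List.range ((j - i).toNat + 1)).map (fun t => F (j - (t:ℤ)))).prod else 1

/-- The σ-field `ℱ(k-1) = σ(𝒜(s), v(s), H_i(s), λ_{ji}(s) : 1 ≤ i,j ≤ N, 0 ≤ s ≤ k-1)`,
generated by the randomness strictly before time `k` (trivial for `k = 0`). -/
def sigBeforeD {Ω : Type*} {N n : ℕ} {ni : Fin N → ℕ}
    (H : ℕ → ∀ i : Fin N, Ω → Matrix (Fin (ni i)) (Fin n) ℝ)
    (v : ℕ → Ω → ∀ i : Fin N, Fin (ni i) → ℝ)
    (A : ℕ → Ω → Matrix (Fin N) (Fin N) ℝ)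
    (lam : ℕ → Fin N → Fin N → Ω → ℕ) (k : ℕ) : MeasurableSpace Ω :=
  ⨆ s, ⨆ _ : s < k,
    MeasurableSpace.comap
        (fun ω (i : Fin N) (p : Fin (ni i)) (c : Fin n) => H s i ω p c) inferInstance
    ⊔ MeasurableSpace.comap (v s) inferInstance
    ⊔ MeasurableSpace.comap (fun ω (i j : Fin N) => A s ω i j) inferInstance
    ⊔ MeasurableSpace.comap (fun ω (j i : Fin N) => lam s j i ω) inferInstance

section Scalar

lemma tendsto_zero_of_le_one_sub_add {u α s : ℕ → ℝ} {c C : ℝ} (hc : 0 < c) (hC : 0 ≤ C)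
    (hu : ∀ m, 0 ≤ u m) (hs : ∀ m, 0 ≤ s m) (m₀ : ℕ)
    (hrec : ∀ m, m₀ ≤ m → u (m + 1) ≤ (1 - c * α m + C * (s m - s (m + 1))) * u m)
    (hdiv : Tendsto (fun M => ∑ m ∈ Finset.range M, α m) atTop atTop) :
    Tendsto u atTop (𝓝 0) := by
  set S : ℕ → ℝ := fun M => ∑ m ∈ Finset.range M, α m with hS
  have key : ∀ m, m₀ ≤ m →
      u m ≤ u m₀ * Real.exp (-c * (S m - S m₀) + C * (s m₀ - s m)) := by
    intro m hm
    induction m, hm using Nat.le_induction with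
    | base => simp
    | succ m hm ih =>
      have h1 : 1 - c * α m + C * (s m - s (m + 1)) ≤
          Real.exp (-c * α m + C * (s m - s (m + 1))) := by
        have := Real.add_one_le_exp (-c * α m + C * (s m - s (m + 1)))
        linarith
      have hSs : S (m + 1) = S m + α m := Finset.sum_range_succ _ _
      calc u (m + 1) ≤ (1 - c * α m + C * (s m - s (m + 1))) * u m := hrec m hm
        _ ≤ Real.exp (-c * α m + C * (s m - s (m + 1))) *
            (u m₀ * Real.exp (-c * (S m - S m₀) + C * (s m₀ - s m))) :=
          mul_le_mul h1 ih (hu m) (Real.exp_pos _).le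
        _ = u m₀ * Real.exp (-c * (S (m + 1) - S m₀) + C * (s m₀ - s (m + 1))) := by
          rw [mul_left_comm, ← Real.exp_add, hSs]
          ring_nf
  have hexp : Tendsto (fun m => u m₀ * Real.exp (-c * (S m - S m₀) + C * s m₀)) atTop (𝓝 0) := by
    rw [← mul_zero (u m₀)]
    refine Tendsto.const_mul _ (Real.tendsto_exp_atBot.comp ?_)
    refine tendsto_atBot_add_const_right _ _ ?_
    exact (tendsto_atTop_add_const_right _ (-S m₀) hdiv).const_mul_atTop_of_neg (by linarith)
  refine squeeze_zero' (Eventually.of_forall hu) ?_ hexp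
  filter_upwards [eventually_ge_atTop m₀] with m hm
  refine (key m hm).trans (mul_le_mul_of_nonneg_left (Real.exp_le_exp.2 ?_) (hu _))
  nlinarith [mul_nonneg hC (hs m)]

lemma tendsto_sum_comp_mul_atTop {a : ℕ → ℝ} (haanti : Antitone a)
    (hadiv : Tendsto (fun K => ∑ k ∈ Finset.range K, a k) atTop atTop) {h : ℕ} (hh : 1 ≤ h) :
    Tendsto (fun M => ∑ m ∈ Finset.range M, a (m * h)) atTop atTop := by
  have hle : ∀ M, ∑ k ∈ Finset.range (M * h), a k ≤ h * ∑ m ∈ Finset.range M, a (m * h) := by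
    intro M
    induction M with
    | zero => simp
    | succ M ih =>
      rw [Finset.sum_range_succ, Nat.succ_mul, Finset.sum_range_add, mul_add]
      refine add_le_add ih ?_
      calc ∑ x ∈ Finset.range h, a (M * h + x) ≤ ∑ _x ∈ Finset.range h, a (M * h) :=
            Finset.sum_le_sum fun x _ => haanti (Nat.le_add_right _ _)
        _ = h * a (M * h) := by simp
  have hpos : (0 : ℝ) < h := by exact_mod_cast hh
  have h1 : Tendsto (fun M => ∑ k ∈ Finset.range (M * h), a k) atTop atTop :=
    hadiv.comp (tendsto_id.atTop_mul_const' (by omega))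
  have h2 := tendsto_atTop_mono hle h1
  exact (tendsto_const_mul_atTop_of_pos hpos).1 h2

lemma div_sub_one_mul_le_sqrt_sub {x y z b C : ℝ} (hy : 0 < y) (hzy : z ≤ y)
    (hyx : y ≤ x) (hxC : x ≤ C * y) (hby : b ^ 2 ≤ y) :
    (x / y - 1) * b ≤ (Real.sqrt C + 1) * (Real.sqrt x - Real.sqrt z) := by
  have hC : 0 ≤ C := by
    by_contra hC
    nlinarith
  have hsy : 0 < Real.sqrt y := Real.sqrt_pos.2 hy
  have hsx : Real.sqrt y ≤ Real.sqrt x := Real.sqrt_le_sqrt hyx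
  have hsz : Real.sqrt z ≤ Real.sqrt y := Real.sqrt_le_sqrt hzy
  have hsC : Real.sqrt x ≤ Real.sqrt C * Real.sqrt y := by
    rw [← Real.sqrt_mul hC]; exact Real.sqrt_le_sqrt hxC
  have hb : b ≤ Real.sqrt y := Real.le_sqrt_of_sq_le hby
  have hx2 : Real.sqrt x ^ 2 = x := Real.sq_sqrt (by linarith)
  have hy2 : Real.sqrt y ^ 2 = y := Real.sq_sqrt hy.le
  have h0 : 0 ≤ x / y - 1 := by rw [sub_nonneg, one_le_div hy]; exact hyx
  calc (x / y - 1) * b ≤ (x / y - 1) * Real.sqrt y := mul_le_mul_of_nonneg_left hb h0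
    _ = (Real.sqrt x / Real.sqrt y + 1) * (Real.sqrt x - Real.sqrt y) := by
      rw [← hx2, ← hy2]; simp only [Real.sqrt_sq hsy.le, Real.sqrt_sq (hsy.le.trans hsx)]
      field_simp
      ring
    _ ≤ (Real.sqrt C + 1) * (Real.sqrt x - Real.sqrt z) := by
      refine mul_le_mul ?_ (by linarith) (by linarith) (by positivity)
      have : Real.sqrt x / Real.sqrt y ≤ Real.sqrt C := by rw [div_le_iff₀ hsy]; exact hsC
      linarith

/-- The contraction supplied by one excitation block, once the weights `1 / a k` are removed. -/
lemma exists_block_contraction {a b : ℕ → ℝ} (hapos : ∀ k, 0 < a k)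
    (haanti : Antitone a) {h : ℕ} (hh : 1 ≤ h)
    (haOshift : a =O[atTop] fun k => a (k + h))
    (hbo : (fun k => (b k) ^ 2) =o[atTop] a) {θ : ℝ} (hθ : 0 < θ) {G K : ℝ} (hG : 0 ≤ G)
    (hK : 0 ≤ K) :
    ∃ C, 0 ≤ C ∧ ∃ m₀ : ℕ, ∀ m, m₀ ≤ m → ∀ (g : ℕ → ℝ) (u : ℝ), 0 ≤ u →
      (∀ k ∈ Finset.Ico (m * h) ((m + 1) * h), |g k| ≤ G * b k * u) →
      θ * u ≤ ∑ k ∈ Finset.Ico (m * h) ((m + 1) * h), (a k)⁻¹ * g k →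
      u - ∑ k ∈ Finset.Ico (m * h) ((m + 1) * h), g k + K * b (m * h) ^ 2 * u ≤
        (1 - θ / 2 * a (m * h) +
          C * (Real.sqrt (a (m * h)) - Real.sqrt (a ((m + 1) * h)))) * u := by
  obtain ⟨C, hC⟩ := haOshift.bound
  have hb1 := hbo.bound one_pos
  have hb2 := hbo.bound (show 0 < θ / (2 * (K + 1)) by positivity)
  obtain ⟨k₀, hk₀⟩ := eventually_atTop.1 (hC.and (hb1.and hb2))
  refine ⟨h * (G * (Real.sqrt C + 1)), by positivity, k₀, fun m hm g u hu hg hsum => ?_⟩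
  have hmh : k₀ ≤ m * h := hm.trans (Nat.le_mul_of_pos_right _ hh)
  set x := a (m * h) with hx
  have hsucc : (m + 1) * h = m * h + h := by ring
  have hterm : ∀ k ∈ Finset.Ico (m * h) ((m + 1) * h),
      x * ((a k)⁻¹ * g k) - g k ≤
        G * (Real.sqrt C + 1) * (Real.sqrt x - Real.sqrt (a ((m + 1) * h))) * u := by
    intro k hk
    have hk' := Finset.mem_Ico.1 hk
    have hak := hapos k
    have hax : a k ≤ x := haanti hk'.1
    have haz : a ((m + 1) * h) ≤ a k := haanti hk'.2.le
    have hCx := (hk₀ _ hmh).1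
    simp only [Real.norm_eq_abs, abs_of_pos (hapos _)] at hCx
    rw [← hsucc] at hCx
    have hC0 : 0 ≤ C := by
      by_contra hcon
      nlinarith [hapos (m * h), hapos ((m + 1) * h)]
    have hbk := (hk₀ _ (hmh.trans hk'.1)).2.1
    simp only [Real.norm_eq_abs, abs_of_pos (hapos _), one_mul, abs_sq] at hbk
    have h1 := div_sub_one_mul_le_sqrt_sub (C := C) hak haz hax
      (hCx.trans (mul_le_mul_of_nonneg_left haz hC0)) hbk
    have h0 : 0 ≤ x / a k - 1 := by rw [sub_nonneg, one_le_div hak]; exact hax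
    calc x * ((a k)⁻¹ * g k) - g k = (x / a k - 1) * g k := by field_simp
      _ ≤ (x / a k - 1) * (G * b k * u) :=
        mul_le_mul_of_nonneg_left ((le_abs_self _).trans (hg k hk)) h0
      _ = G * u * ((x / a k - 1) * b k) := by ring
      _ ≤ G * u * ((Real.sqrt C + 1) * (Real.sqrt x - Real.sqrt (a ((m + 1) * h)))) :=
        mul_le_mul_of_nonneg_left h1 (by positivity)
      _ = _ := by ring
  have hS := Finset.sum_le_sum hterm
  rw [Finset.sum_sub_distrib, ← Finset.mul_sum, Finset.sum_const, Nat.card_Ico, hsucc,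
    Nat.add_sub_cancel_left, nsmul_eq_mul, ← hsucc] at hS
  have hb3 := (hk₀ _ hmh).2.2
  simp only [Real.norm_eq_abs, abs_of_pos (hapos _), abs_sq] at hb3
  have hKb : K * b (m * h) ^ 2 ≤ θ / 2 * x := by
    calc K * b (m * h) ^ 2 ≤ (K + 1) * (θ / (2 * (K + 1)) * x) :=
          mul_le_mul (by linarith) hb3 (sq_nonneg _) (by linarith)
      _ = θ / 2 * x := by field_simp
  have hxs := mul_le_mul_of_nonneg_left hsum (hapos (m * h)).le
  have hKu := mul_le_mul_of_nonneg_right hKb hu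
  rw [← hx] at hxs
  linarith

end Scalar

section Hilbert

variable {E : Type*} [NormedAddCommGroup E] [InnerProductSpace ℝ E]

/-- First-order expansion of the squared norm along `h` steps of `y ↦ y - G y`. -/
lemma norm_sq_le_of_iterate_sub {G : ℕ → E →L[ℝ] E} {y : ℕ → E} {g : ℝ} {h : ℕ} (hg0 : 0 ≤ g)
    (hg : ∀ t < h, ‖G t‖ ≤ g) (hg1 : ∀ t < h, ‖G t‖ ≤ 1)
    (hy : ∀ t < h, y (t + 1) = y t - G t (y t)) :
    ‖y h‖ ^ 2 ≤ ‖y 0‖ ^ 2 - ∑ t ∈ Finset.range h, 2 * inner ℝ (y 0) (G t (y 0)) +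
      h * ((5 * h + 1) * 4 ^ h) * g ^ 2 * ‖y 0‖ ^ 2 := by
  have hnorm : ∀ t ≤ h, ‖y t‖ ≤ 2 ^ t * ‖y 0‖ := by
    intro t ht
    induction t with
    | zero => simp
    | succ t ih =>
      have h1 := ih (by omega)
      have h2 : ‖G t (y t)‖ ≤ ‖y t‖ := by
        simpa using (G t).le_of_opNorm_le (hg1 t (by omega)) (y t)
      rw [hy t (by omega), pow_succ]
      linarith [norm_sub_le (y t) (G t (y t))]
  have hnormh : ∀ t ≤ h, ‖y t‖ ≤ 2 ^ h * ‖y 0‖ := fun t ht =>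
    (hnorm t ht).trans (mul_le_mul_of_nonneg_right (pow_le_pow_right₀ (by norm_num) ht)
      (norm_nonneg _))
  have hdiff : ∀ t ≤ h, ‖y t - y 0‖ ≤ t * (g * (2 ^ h * ‖y 0‖)) := by
    intro t ht
    induction t with
    | zero => simp
    | succ t ih =>
      have h1 := ih (by omega)
      have h2 : ‖G t (y t)‖ ≤ g * (2 ^ h * ‖y 0‖) :=
        ((G t).le_of_opNorm_le (hg t (by omega)) (y t)).trans
          (mul_le_mul_of_nonneg_left (hnormh t (by omega)) hg0)
      rw [hy t (by omega), sub_right_comm]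
      push_cast
      linarith [norm_sub_le (y t - y 0) (G t (y t))]
  have hstep : ∀ t < h, ‖y (t + 1)‖ ^ 2 ≤ ‖y t‖ ^ 2 - 2 * inner ℝ (y 0) (G t (y 0)) +
      (5 * h + 1) * 4 ^ h * g ^ 2 * ‖y 0‖ ^ 2 := by
    intro t ht
    set B := 2 ^ h * ‖y 0‖ with hB
    have hB0 : 0 ≤ B := by positivity
    have hyB : ‖y t‖ ≤ B := hnormh t ht.le
    have hy0B : ‖y 0‖ ≤ B := hnormh 0 (Nat.zero_le _)
    have hGy : ‖G t (y t)‖ ≤ g * B :=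
      ((G t).le_of_opNorm_le (hg t ht) (y t)).trans (mul_le_mul_of_nonneg_left hyB hg0)
    have hd : ‖y t - y 0‖ ≤ h * (g * B) :=
      (hdiff t ht.le).trans (mul_le_mul_of_nonneg_right (by exact_mod_cast ht.le) (by positivity))
    have hGd : ‖G t (y t - y 0)‖ ≤ g * (h * (g * B)) :=
      ((G t).le_of_opNorm_le (hg t ht) _).trans (mul_le_mul_of_nonneg_left hd hg0)
    have hsplit : inner ℝ (y t) (G t (y t)) = inner ℝ (y 0) (G t (y 0)) +
        inner ℝ (y t - y 0) (G t (y t)) + inner ℝ (y 0) (G t (y t - y 0)) := by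
      simp only [map_sub, inner_sub_left, inner_sub_right]
      ring
    have i1 : |inner ℝ (y t - y 0) (G t (y t))| ≤ h * (g * B) * (g * B) :=
      (abs_real_inner_le_norm _ _).trans (mul_le_mul hd hGy (norm_nonneg _) (by positivity))
    have i2 : |inner ℝ (y 0) (G t (y t - y 0))| ≤ B * (g * (h * (g * B))) :=
      (abs_real_inner_le_norm _ _).trans (mul_le_mul hy0B hGd (norm_nonneg _) (by positivity))
    have hsq : ‖G t (y t)‖ ^ 2 ≤ (g * B) ^ 2 := pow_le_pow_left₀ (norm_nonneg _) hGy 2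
    have hB2 : B ^ 2 = 4 ^ h * ‖y 0‖ ^ 2 := by
      rw [hB, mul_pow, ← pow_mul, mul_comm h 2, pow_mul]; norm_num
    have hpos : 0 ≤ (h : ℝ) * (g ^ 2 * B ^ 2) := by positivity
    rw [hy t ht, norm_sub_sq_real, hsplit]
    have e : (5 * h + 1) * 4 ^ h * g ^ 2 * ‖y 0‖ ^ 2 = (5 * h + 1) * g ^ 2 * B ^ 2 := by
      rw [hB2]; ring
    rw [e]
    nlinarith [neg_abs_le (inner ℝ (y t - y 0) (G t (y t))),
      neg_abs_le (inner ℝ (y 0) (G t (y t - y 0)))]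
  have hind : ∀ t ≤ h, ‖y t‖ ^ 2 ≤ ‖y 0‖ ^ 2 -
      ∑ s ∈ Finset.range t, 2 * inner ℝ (y 0) (G s (y 0)) +
      t * ((5 * h + 1) * 4 ^ h * g ^ 2 * ‖y 0‖ ^ 2) := by
    intro t ht
    induction t with
    | zero => simp
    | succ t ih =>
      rw [Finset.sum_range_succ]
      push_cast
      linarith [ih (by omega), hstep t (by omega)]
  refine (hind h le_rfl).trans (le_of_eq ?_)
  ring

end Hilbert

section MatrixNorm

open scoped Matrix.Norms.L2Operator

variable {p q : Type*} [Fintype p] [Fintype q] [DecidableEq q]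

lemma specNorm_eq_norm (A : Matrix p q ℝ) : specNorm A = ‖A‖ := rfl

lemma sum_sq_mulVec_le (A : Matrix p q ℝ) (x : q → ℝ) :
    ∑ i, (A *ᵥ x) i ^ 2 ≤ ‖A‖ ^ 2 * ∑ j, x j ^ 2 := by
  have h := pow_le_pow_left₀ (norm_nonneg _) (Matrix.l2_opNorm_mulVec A (WithLp.toLp 2 x)) 2
  rw [mul_pow, EuclideanSpace.real_norm_sq_eq, EuclideanSpace.real_norm_sq_eq] at h
  exact h

lemma l2_opNorm_le_of_sum_sq_le {A : Matrix p q ℝ} {c : ℝ} (hc : 0 ≤ c)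
    (h : ∀ x : q → ℝ, ∑ i, (A *ᵥ x) i ^ 2 ≤ c ^ 2 * ∑ j, x j ^ 2) : ‖A‖ ≤ c := by
  rw [Matrix.l2_opNorm_def]
  refine ContinuousLinearMap.opNorm_le_bound _ hc fun x => ?_
  refine (sq_le_sq₀ (norm_nonneg _) (by positivity)).1 ?_
  rw [mul_pow, EuclideanSpace.real_norm_sq_eq, EuclideanSpace.real_norm_sq_eq]
  exact h x

lemma norm_kronecker_one_le {N n : ℕ} {B : Matrix (Fin N) (Fin N) ℝ} {c : ℝ} (hc : 0 ≤ c)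
    (hB : ∑ i, ∑ j, B i j ^ 2 ≤ c ^ 2) : ‖B ⊗ₖ (1 : Matrix (Fin n) (Fin n) ℝ)‖ ≤ c := by
  refine l2_opNorm_le_of_sum_sq_le hc fun x => ?_
  have hentry : ∀ i r, ((B ⊗ₖ (1 : Matrix (Fin n) (Fin n) ℝ)) *ᵥ x) (i, r) =
      ∑ j, B i j * x (j, r) := by
    intro i r
    simp [Matrix.mulVec, dotProduct, Fintype.sum_prod_type, Matrix.kroneckerMap_apply,
      Matrix.one_apply]
  calc ∑ i, ((B ⊗ₖ (1 : Matrix (Fin n) (Fin n) ℝ)) *ᵥ x) i ^ 2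
      = ∑ i, ∑ r, (∑ j, B i j * x (j, r)) ^ 2 := by
        simp only [Fintype.sum_prod_type, hentry]
    _ ≤ ∑ i, ∑ r, (∑ j, B i j ^ 2) * ∑ j, x (j, r) ^ 2 :=
        Finset.sum_le_sum fun i _ => Finset.sum_le_sum fun r _ =>
          Finset.sum_mul_sq_le_sq_mul_sq _ _ _
    _ = (∑ i, ∑ j, B i j ^ 2) * ∑ j, x j ^ 2 := by
        simp only [← Finset.mul_sum, ← Finset.sum_mul]
        rw [Fintype.sum_prod_type_right]
    _ ≤ c ^ 2 * ∑ j, x j ^ 2 :=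
        mul_le_mul_of_nonneg_right hB (Finset.sum_nonneg fun _ _ => sq_nonneg _)

lemma norm_blockHtH_le {N n : ℕ} {ni : Fin N → ℕ} {β : ℝ} (hβ : 0 ≤ β)
    (H : ∀ i : Fin N, Matrix (Fin (ni i)) (Fin n) ℝ) (hH : ∀ i, specNorm (H i) ≤ β) :
    ‖blockHtH H‖ ≤ β ^ 2 := by
  refine l2_opNorm_le_of_sum_sq_le (by positivity) fun x => ?_
  have hentry : ∀ i r, (blockHtH H *ᵥ x) (i, r) =
      (((H i)ᵀ * H i) *ᵥ fun s => x (i, s)) r := by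
    intro i r
    simp [Matrix.mulVec, dotProduct, Fintype.sum_prod_type, blockHtH, ite_mul,
      Finset.sum_ite_irrel]
  have hHH : ∀ i, ‖(H i)ᵀ * H i‖ ≤ β ^ 2 := by
    intro i
    have h1 := Matrix.l2_opNorm_conjTranspose_mul_self (H i)
    rw [Matrix.conjTranspose_eq_transpose_of_trivial] at h1
    rw [h1, pow_two]
    exact mul_le_mul (hH i) (hH i) (norm_nonneg _) hβ
  simp only [Fintype.sum_prod_type, hentry, Finset.mul_sum]
  refine Finset.sum_le_sum fun i _ => ?_
  rw [← Finset.mul_sum]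
  exact (sum_sq_mulVec_le _ _).trans (mul_le_mul_of_nonneg_right
    (pow_le_pow_left₀ (norm_nonneg _) (hHH i) 2) (Finset.sum_nonneg fun _ _ => sq_nonneg _))

lemma abs_entry_le_norm (A : Matrix p q ℝ) (i : p) (j : q) : |A i j| ≤ ‖A‖ := by
  have h := sum_sq_mulVec_le A (Pi.single j 1)
  have h1 : A i j ^ 2 ≤ ∑ i, (A *ᵥ Pi.single j 1) i ^ 2 := by
    refine le_trans ?_ (Finset.single_le_sum (fun _ _ => sq_nonneg _) (Finset.mem_univ i))
    simp
  have h2 : ∑ l, (Pi.single j (1 : ℝ) : q → ℝ) l ^ 2 = 1 := by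
    simp [Pi.single_apply, ite_pow]
  rw [h2, mul_one] at h
  exact abs_le_of_sq_le_sq (h1.trans h) (norm_nonneg _)

lemma lambdaMin_mul_le (A : Matrix p p ℝ) (y : p → ℝ) :
    lambdaMin A * ∑ i, y i ^ 2 ≤ y ⬝ᵥ A *ᵥ y := by
  set s := ∑ i, y i ^ 2 with hs
  have hs0 : 0 ≤ s := Finset.sum_nonneg fun _ _ => sq_nonneg _
  rcases hs0.eq_or_lt with h0 | hpos
  · have hy : y = 0 := by
      funext i
      have := (Finset.sum_eq_zero_iff_of_nonneg fun i _ => sq_nonneg (y i)).1 h0.symm i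
        (Finset.mem_univ i)
      exact pow_eq_zero_iff two_ne_zero |>.1 this
    rw [← h0, hy]; simp
  have hbdd : BddBelow (Set.range fun x : {x : p → ℝ // ∑ i, x i ^ 2 = 1} =>
      x.1 ⬝ᵥ A *ᵥ x.1) := by
    refine ⟨-∑ i, ∑ j, |A i j|, ?_⟩
    rintro _ ⟨x, rfl⟩
    have hx1 : ∀ i, |x.1 i| ≤ 1 := by
      intro i
      have : x.1 i ^ 2 ≤ 1 := by
        refine le_trans ?_ x.2.le
        exact Finset.single_le_sum (f := fun i => x.1 i ^ 2) (fun _ _ => sq_nonneg _)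
          (Finset.mem_univ i)
      exact abs_le_of_sq_le_sq (by simpa using this) zero_le_one
    refine neg_le_of_abs_le ?_
    simp only [dotProduct, Matrix.mulVec, Finset.mul_sum]
    refine (Finset.abs_sum_le_sum_abs _ _).trans (Finset.sum_le_sum fun i _ => ?_)
    refine (Finset.abs_sum_le_sum_abs _ _).trans (Finset.sum_le_sum fun j _ => ?_)
    rw [abs_mul, abs_mul]
    calc |x.1 i| * (|A i j| * |x.1 j|) ≤ 1 * (|A i j| * 1) := by
          gcongr <;> exact hx1 _
      _ = |A i j| := by ring
  have hsq : Real.sqrt s ^ 2 = s := Real.sq_sqrt hs0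
  have hsp : 0 < Real.sqrt s := Real.sqrt_pos.2 hpos
  have hunit : ∑ i, ((Real.sqrt s)⁻¹ • y) i ^ 2 = 1 := by
    simp only [Pi.smul_apply, smul_eq_mul, mul_pow, ← Finset.mul_sum, inv_pow, hsq, ← hs]
    exact inv_mul_cancel₀ hpos.ne'
  have := ciInf_le hbdd ⟨(Real.sqrt s)⁻¹ • y, hunit⟩
  simp only [Matrix.mulVec_smul, smul_dotProduct, dotProduct_smul, smul_eq_mul] at this
  calc lambdaMin A * s ≤ (Real.sqrt s)⁻¹ * ((Real.sqrt s)⁻¹ * (y ⬝ᵥ A *ᵥ y)) * s :=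
        mul_le_mul_of_nonneg_right this hs0
    _ = y ⬝ᵥ A *ᵥ y := by
        rw [← mul_assoc, ← mul_inv, ← pow_two, hsq]; field_simp

variable [DecidableEq p]

lemma l2_opNorm_one_le : ‖(1 : Matrix p p ℝ)‖ ≤ 1 :=
  l2_opNorm_le_of_sum_sq_le zero_le_one fun x => by simp

lemma isUnit_det_and_norm_inv_le {κ : ℝ} (hκ : κ < 1) {F : Matrix p p ℝ} (hF : ‖1 - F‖ ≤ κ) :
    IsUnit F.det ∧ ‖F⁻¹‖ ≤ (1 - κ)⁻¹ := by
  have hunit : IsUnit F := by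
    have := isUnit_one_sub_of_norm_lt_one (hF.trans_lt hκ)
    rwa [sub_sub_cancel] at this
  have hdet := (Matrix.isUnit_iff_isUnit_det F).1 hunit
  refine ⟨hdet, ?_⟩
  have hid : F⁻¹ = 1 + (1 - F) * F⁻¹ := by
    rw [sub_mul, Matrix.mul_nonsing_inv _ hdet, one_mul]; abel
  have h1 : ‖F⁻¹‖ ≤ 1 + κ * ‖F⁻¹‖ := by
    calc ‖F⁻¹‖ = ‖1 + (1 - F) * F⁻¹‖ := by rw [← hid]
      _ ≤ ‖(1 : Matrix p p ℝ)‖ + ‖(1 - F) * F⁻¹‖ := norm_add_le _ _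
      _ ≤ 1 + κ * ‖F⁻¹‖ := add_le_add l2_opNorm_one_le
        ((norm_mul_le _ _).trans (mul_le_mul_of_nonneg_right hF (norm_nonneg _)))
  rw [← one_div (1 - κ), le_div_iff₀ (by linarith)]
  linarith

lemma phiProdZ_eq_list_prod (F : ℤ → Matrix p p ℝ) (j : ℤ) (r : ℕ) :
    phiProdZ F j (j + 1 - r) = ((List.range r).map fun t : ℕ => F (j - t)).prod := by
  unfold phiProdZ
  rcases r with _ | r
  · simp
  · have h1 : (j - (j + 1 - ((r + 1 : ℕ) : ℤ))).toNat + 1 = r + 1 := by push_cast; omega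
    rw [if_pos (by push_cast; omega), h1]
    simp [← List.map_eq_flatMap, Function.comp_def]

lemma phiProdZ_natCast_zero (F : ℤ → Matrix p p ℝ) (k : ℕ) :
    phiProdZ F (k : ℤ) 0 = F k * phiProdZ F ((k : ℤ) - 1) 0 := by
  have h1 := phiProdZ_eq_list_prod F k (k + 1)
  have h2 := phiProdZ_eq_list_prod F ((k : ℤ) - 1) k
  have e1 : (k : ℤ) + 1 - ((k + 1 : ℕ) : ℤ) = 0 := by push_cast; ring
  have e2 : (k : ℤ) - 1 + 1 - (k : ℤ) = 0 := by ring
  rw [e1] at h1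
  rw [e2] at h2
  rw [h1, h2, List.range_succ_eq_map, List.map_cons, List.prod_cons, List.map_map, Nat.cast_zero,
    sub_zero]
  congr 3
  funext t
  simp only [Function.comp_apply]
  congr 1
  push_cast
  ring

lemma norm_phiProdZ_inv_le {κ : ℝ} (hκ : κ < 1) {F : ℤ → Matrix p p ℝ} {j : ℤ} {r : ℕ}
    (hF : ∀ t : ℕ, t < r → ‖1 - F (j - t)‖ ≤ κ) :
    ‖(phiProdZ F j (j + 1 - r))⁻¹‖ ≤ ((1 - κ)⁻¹) ^ r := by
  rw [phiProdZ_eq_list_prod]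
  induction r with
  | zero => simpa using l2_opNorm_one_le
  | succ r ih =>
    rw [List.range_succ, List.map_append, List.prod_append, Matrix.mul_inv_rev, pow_succ']
    refine (norm_mul_le _ _).trans (mul_le_mul ?_ (ih fun t ht => hF t (by omega))
      (norm_nonneg _) (inv_nonneg.2 (by linarith)))
    simpa using (isUnit_det_and_norm_inv_le hκ (hF r (by omega))).2

lemma norm_degMat_kronecker_one_le {N n : ℕ} {A : Matrix (Fin N) (Fin N) ℝ} {β : ℝ} (hβ : 0 ≤ β)
    (hA : ∀ i j, |A i j| ≤ β) :
    ‖degMat A ⊗ₖ (1 : Matrix (Fin n) (Fin n) ℝ)‖ ≤ N * Real.sqrt N * β := by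
  refine norm_kronecker_one_le (by positivity) ?_
  have hrow : ∀ i, (∑ j, A i j) ^ 2 ≤ (N * β) ^ 2 := by
    intro i
    refine sq_le_sq' ?_ ?_
    · have := (Finset.abs_sum_le_sum_abs (fun j => A i j) Finset.univ).trans
        (Finset.sum_le_sum fun j _ => hA i j)
      simp only [Finset.sum_const, Finset.card_univ, Fintype.card_fin, nsmul_eq_mul] at this
      exact (abs_le.1 this).1
    · have := (Finset.abs_sum_le_sum_abs (fun j => A i j) Finset.univ).trans
        (Finset.sum_le_sum fun j _ => hA i j)
      simp only [Finset.sum_const, Finset.card_univ, Fintype.card_fin, nsmul_eq_mul] at this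
      exact (abs_le.1 this).2
  calc ∑ i, ∑ j, degMat A i j ^ 2 = ∑ i, (∑ j, A i j) ^ 2 := by
        simp [degMat, Matrix.diagonal_apply, ite_pow]
    _ ≤ ∑ _i : Fin N, (N * β) ^ 2 := Finset.sum_le_sum fun i _ => hrow i
    _ = (N * Real.sqrt N * β) ^ 2 := by
        simp only [Finset.sum_const, Finset.card_univ, Fintype.card_fin, nsmul_eq_mul, mul_pow,
          Real.sq_sqrt (Nat.cast_nonneg N)]
        ring

lemma norm_delayAdj_le {N n : ℕ} {A : Matrix (Fin N) (Fin N) ℝ} {β : ℝ} (hβ : 0 ≤ β)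
    (hA : ∀ i j, |A i j| ≤ β) (lam : Fin N → Fin N → ℕ) (s : ℕ) :
    ‖delayAdj n A lam s‖ ≤ N * Real.sqrt N * β := by
  rcases Nat.eq_zero_or_pos N with rfl | hN
  · refine norm_kronecker_one_le (by positivity) (by simp)
  refine norm_kronecker_one_le (by positivity) ?_
  have hN1 : (1 : ℝ) ≤ N := by exact_mod_cast hN
  calc ∑ i, ∑ j, (Matrix.hadamard A (delayMat lam s)) i j ^ 2
      ≤ ∑ _i : Fin N, ∑ _j : Fin N, β ^ 2 := by
        refine Finset.sum_le_sum fun i _ => Finset.sum_le_sum fun j _ => ?_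
        have := hA i j
        rw [Matrix.hadamard_apply, delayMat, Matrix.of_apply]
        split_ifs
        · rw [mul_one, ← sq_abs]; exact pow_le_pow_left₀ (abs_nonneg _) this 2
        · simpa using sq_nonneg β
    _ = 1 * ((N : ℝ) ^ 2 * β ^ 2) := by
        simp only [Finset.sum_const, Finset.card_univ, Fintype.card_fin, nsmul_eq_mul]; ring
    _ ≤ N * ((N : ℝ) ^ 2 * β ^ 2) := mul_le_mul_of_nonneg_right hN1 (by positivity)
    _ = (N * Real.sqrt N * β) ^ 2 := by
        simp only [mul_pow, Real.sq_sqrt (Nat.cast_nonneg N)]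
        ring

lemma gain_bound_of_lt_min {x y z κ B : ℝ} {d : ℕ} (hx : 0 < x) (hy : 0 < y) (hz : 0 < z)
    (hκ0 : 0 < κ) (hκ1 : κ < 1) (hB0 : 0 ≤ B)
    (hB : B < min (κ / (2 * (x + y + z)))
      ((1 - (1 - κ)⁻¹) * κ / (2 * y * (1 - (1 - κ) ^ (-(d + 1 : ℤ)))))) :
    B * (y + z + y * ∑ s ∈ Finset.range (d + 1), ((1 - κ)⁻¹) ^ s) ≤ κ := by
  obtain ⟨h1, h2⟩ := lt_min_iff.1 hB
  set r := (1 - κ)⁻¹ with hr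
  have hr1 : 1 < r := by rw [hr]; exact (one_lt_inv₀ (by linarith)).2 (by linarith)
  have hzpow : (1 - κ) ^ (-(d + 1 : ℤ)) = r ^ (d + 1) := by
    rw [_root_.zpow_neg, hr, inv_pow]; norm_cast
  have hgeom := geom_sum_mul r (d + 1)
  set S := ∑ s ∈ Finset.range (d + 1), r ^ s with hS
  have hSpos : 0 < S := Finset.sum_pos (fun s _ => by positivity) (by simp)
  have hq : (1 - r) * κ / (2 * y * (1 - (1 - κ) ^ (-(d + 1 : ℤ)))) = κ / (2 * y * S) := by
    have hne : r - 1 ≠ 0 := by linarith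
    rw [hzpow, show 1 - r ^ (d + 1) = -(S * (r - 1)) by rw [hgeom]; ring,
      show 1 - r = -(r - 1) by ring]
    field_simp
  rw [hq, lt_div_iff₀ (by positivity)] at h2
  rw [lt_div_iff₀ (by positivity)] at h1
  nlinarith [mul_nonneg hB0 hx.le]

/-- The increments `1 - F k` of the delay-elimination recursion are of the order of `b k`, and
uniformly smaller than one. -/
lemma norm_one_sub_delay_recursion_le {N n d : ℕ} {ni : Fin N → ℕ} (hN : 1 ≤ N)
    {H : ℕ → ∀ i : Fin N, Matrix (Fin (ni i)) (Fin n) ℝ}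
    {A : ℕ → Matrix (Fin N) (Fin N) ℝ} {lam : ℕ → Fin N → Fin N → ℕ}
    {a b : ℕ → ℝ} {βa βH : ℝ} (hβa : 0 < βa) (hβH : 0 < βH)
    (hA : ∀ k i j, |A k i j| ≤ βa) (hH : ∀ k i, specNorm (H k i) ≤ βH)
    (hapos : ∀ k, 0 < a k) (hbpos : ∀ k, 0 < b k)
    {Ca : ℝ} (hCa : ∀ k, a k ≤ Ca * b k) {B κ : ℝ} (hbB : ∀ k, b k ≤ B) (hκ0 : 0 < κ)
    (hκ1 : κ < 1)
    (hB : B < min (κ / (2 * (N * βa + N * Real.sqrt N * βa + Ca * βH ^ 2)))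
      ((1 - (1 - κ)⁻¹) * κ / (2 * N * Real.sqrt N * βa * (1 - (1 - κ) ^ (-(d + 1 : ℤ))))))
    {F : ℤ → Matrix (Fin N × Fin n) (Fin N × Fin n) ℝ}
    (hFinit : ∀ k : ℤ, -(d : ℤ) ≤ k → k ≤ -1 → F k = 1)
    (hFrec : ∀ k : ℕ, F k = 1 -
      (b k • (degMat (A k) ⊗ₖ (1 : Matrix (Fin n) (Fin n) ℝ))
        + a k • blockHtH (H k)
        - b k • ∑ s ∈ Finset.range (d + 1),
            delayAdj n (A k) (lam k) s * (phiProdZ F ((k : ℤ) - 1) ((k : ℤ) - s))⁻¹)) (k : ℕ) :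
    ‖1 - F k‖ ≤ b k * (N * Real.sqrt N * βa + Ca * βH ^ 2 +
        N * Real.sqrt N * βa * ∑ s ∈ Finset.range (d + 1), ((1 - κ)⁻¹) ^ s) ∧
      ‖1 - F k‖ ≤ κ ∧
      ∀ s ∈ Finset.range (d + 1),
        ‖(phiProdZ F ((k : ℤ) - 1) ((k : ℤ) - s))⁻¹‖ ≤ ((1 - κ)⁻¹) ^ s := by
  have hN0 : (0 : ℝ) < N := by exact_mod_cast hN
  have hCa0 : 0 < Ca := by
    by_contra hcon
    nlinarith [hCa 0, hapos 0, hbpos 0]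
  have hy : 0 < N * Real.sqrt N * βa := by positivity
  have hgain := gain_bound_of_lt_min (x := N * βa) (z := Ca * βH ^ 2) (by positivity) hy
    (by positivity) hκ0 hκ1 ((hbpos 0).le.trans (hbB 0)) (by convert hB using 4; ring)
  have hS0 : 0 ≤ ∑ s ∈ Finset.range (d + 1), ((1 - κ)⁻¹) ^ s :=
    Finset.sum_nonneg fun s _ => pow_nonneg (inv_nonneg.2 (by linarith)) s
  induction k using Nat.strong_induction_on with
  | _ k ih =>
    have hprev : ∀ t : ℕ, t < d → ‖1 - F ((k : ℤ) - 1 - t)‖ ≤ κ := by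
      intro t ht
      rcases Nat.lt_or_ge t k with htk | htk
      · obtain ⟨l, hl⟩ : ∃ l : ℕ, (k : ℤ) - 1 - t = l := ⟨k - 1 - t, by omega⟩
        rw [hl]
        exact (ih l (by omega)).2.1
      · rw [hFinit _ (by omega) (by omega), sub_self, norm_zero]
        exact hκ0.le
    have hinv : ∀ s ∈ Finset.range (d + 1),
        ‖(phiProdZ F ((k : ℤ) - 1) ((k : ℤ) - s))⁻¹‖ ≤ ((1 - κ)⁻¹) ^ s := by
      intro s hs
      have hs' := Finset.mem_range.1 hs
      have h1 := norm_phiProdZ_inv_le (j := (k : ℤ) - 1) (r := s) hκ1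
        fun t ht => hprev t (by omega)
      rwa [sub_add_cancel] at h1
    have hbk := (hbpos k).le
    have hbound : ‖1 - F k‖ ≤ b k * (N * Real.sqrt N * βa + Ca * βH ^ 2 +
        N * Real.sqrt N * βa * ∑ s ∈ Finset.range (d + 1), ((1 - κ)⁻¹) ^ s) := by
      rw [hFrec k, sub_sub_cancel]
      have n1 := norm_degMat_kronecker_one_le (n := n) hβa.le (hA k)
      have n2 := norm_blockHtH_le hβH.le (H k) (hH k)
      have n3 : ‖∑ s ∈ Finset.range (d + 1),
            delayAdj n (A k) (lam k) s * (phiProdZ F ((k : ℤ) - 1) ((k : ℤ) - s))⁻¹‖ ≤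
          N * Real.sqrt N * βa * ∑ s ∈ Finset.range (d + 1), ((1 - κ)⁻¹) ^ s := by
        rw [Finset.mul_sum]
        refine norm_sum_le_of_le _ fun s hs => (norm_mul_le _ _).trans ?_
        exact mul_le_mul (norm_delayAdj_le hβa.le (hA k) _ s) (hinv s hs) (norm_nonneg _) hy.le
      refine (norm_sub_le _ _).trans ?_
      refine (add_le_add_left (norm_add_le _ _) _).trans ?_
      rw [norm_smul, norm_smul, norm_smul, Real.norm_of_nonneg hbk,
        Real.norm_of_nonneg (hapos k).le]
      have t1 := mul_le_mul_of_nonneg_left n1 hbk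
      have t2 := mul_le_mul (hCa k) n2 (norm_nonneg _) (mul_nonneg hCa0.le hbk)
      have t3 := mul_le_mul_of_nonneg_left n3 hbk
      nlinarith
    refine ⟨hbound, hbound.trans ((mul_le_mul_of_nonneg_right (hbB k) ?_).trans hgain), hinv⟩
    positivity

end MatrixNorm

section EntrywiseMeasurable

/-- All entries of the random matrix `M` are measurable with respect to `m`. -/
def EntrywiseMeasurable {Ω p q : Type*} (m : MeasurableSpace Ω) (M : Ω → Matrix p q ℝ) : Prop :=
  ∀ i j, Measurable[m] fun ω => M ω i j

namespace EntrywiseMeasurable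

variable {Ω p q r : Type*} {m m' : MeasurableSpace Ω}

lemma mono {M : Ω → Matrix p q ℝ} (hM : EntrywiseMeasurable m M) (h : m ≤ m') :
    EntrywiseMeasurable m' M := fun i j => (hM i j).mono h le_rfl

lemma const (M : Matrix p q ℝ) : EntrywiseMeasurable m fun _ : Ω => M :=
  fun _ _ => measurable_const

lemma transpose {M : Ω → Matrix p q ℝ} (hM : EntrywiseMeasurable m M) :
    EntrywiseMeasurable m fun ω => (M ω)ᵀ := fun i j => hM j i

lemma add {M M' : Ω → Matrix p q ℝ} (hM : EntrywiseMeasurable m M)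
    (hM' : EntrywiseMeasurable m M') : EntrywiseMeasurable m fun ω => M ω + M' ω :=
  fun i j => (hM i j).add (hM' i j)

lemma sub {M M' : Ω → Matrix p q ℝ} (hM : EntrywiseMeasurable m M)
    (hM' : EntrywiseMeasurable m M') : EntrywiseMeasurable m fun ω => M ω - M' ω :=
  fun i j => (hM i j).sub (hM' i j)

lemma const_smul {M : Ω → Matrix p q ℝ} (hM : EntrywiseMeasurable m M) (c : ℝ) :
    EntrywiseMeasurable m fun ω => c • M ω := fun i j => (hM i j).const_mul c

lemma sum {ι : Type*} {s : Finset ι} {M : ι → Ω → Matrix p q ℝ}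
    (hM : ∀ t ∈ s, EntrywiseMeasurable m (M t)) :
    EntrywiseMeasurable m fun ω => ∑ t ∈ s, M t ω := by
  intro i j
  simp only [Matrix.sum_apply]
  exact Finset.measurable_fun_sum s fun t ht => hM t ht i j

lemma mul [Fintype q] {M : Ω → Matrix p q ℝ} {M' : Ω → Matrix q r ℝ}
    (hM : EntrywiseMeasurable m M) (hM' : EntrywiseMeasurable m M') :
    EntrywiseMeasurable m fun ω => M ω * M' ω := by
  intro i j
  simp only [Matrix.mul_apply]
  exact Finset.measurable_fun_sum _ fun t _ => (hM i t).mul (hM' t j)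

lemma kronecker_one {s : Type*} [DecidableEq s] {M : Ω → Matrix p q ℝ}
    (hM : EntrywiseMeasurable m M) :
    EntrywiseMeasurable m fun ω => M ω ⊗ₖ (1 : Matrix s s ℝ) := by
  intro i j
  simp only [Matrix.kroneckerMap_apply]
  exact (hM i.1 j.1).mul_const _

variable [Fintype p]

lemma comp_continuous {M : Ω → Matrix p p ℝ} (hM : EntrywiseMeasurable m M)
    {f : Matrix p p ℝ → ℝ} (hf : Continuous f) : Measurable[m] fun ω => f (M ω) := by
  have h1 : Measurable[m] fun ω => (fun i j => M ω i j : p → p → ℝ) :=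
    measurable_pi_iff.2 fun i => measurable_pi_iff.2 fun j => hM i j
  have h2 : Continuous fun g : p → p → ℝ => f (Matrix.of g) := hf.comp continuous_id
  exact h2.measurable.comp h1

variable [DecidableEq p]

lemma inv {M : Ω → Matrix p p ℝ} (hM : EntrywiseMeasurable m M) :
    EntrywiseMeasurable m fun ω => (M ω)⁻¹ := by
  intro i j
  simp only [Matrix.inv_def, Ring.inverse_eq_inv', Matrix.smul_apply, smul_eq_mul]
  exact (hM.comp_continuous continuous_id.matrix_det).inv.mul
    (hM.comp_continuous (continuous_id.matrix_adjugate.matrix_elem i j))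

lemma list_prod {M : ℕ → Ω → Matrix p p ℝ} {l : ℕ}
    (hM : ∀ t < l, EntrywiseMeasurable m (M t)) :
    EntrywiseMeasurable m fun ω => ((List.range l).map fun t => M t ω).prod := by
  induction l with
  | zero => simpa using const (m := m) (1 : Matrix p p ℝ)
  | succ l ih =>
    simp only [List.range_succ, List.map_append, List.prod_append, List.map_cons, List.map_nil,
      List.prod_singleton]
    exact (ih fun t ht => hM t (by omega)).mul (hM l (by omega))

lemma phiProdZ {F : ℤ → Ω → Matrix p p ℝ} {j : ℤ} {l : ℕ}
    (hF : ∀ t : ℕ, t < l → EntrywiseMeasurable m (F (j - t))) :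
    EntrywiseMeasurable m fun ω => _root_.phiProdZ (fun t => F t ω) j (j + 1 - l) := by
  simp only [phiProdZ_eq_list_prod]
  exact list_prod hF

open scoped Matrix.Norms.L2Operator in
lemma integrable_of_norm_le [mΩ : MeasurableSpace Ω] {μ : Measure Ω} [IsFiniteMeasure μ]
    {M : Ω → Matrix p p ℝ} (hM : EntrywiseMeasurable mΩ M) {C : ℝ}
    (hC : ∀ᵐ ω ∂μ, ‖M ω‖ ≤ C) (i j : p) : Integrable (fun ω => M ω i j) μ := by
  refine Integrable.of_bound (hM i j).aestronglyMeasurable C ?_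
  filter_upwards [hC] with ω hω
  exact (abs_entry_le_norm (M ω) i j).trans hω

end EntrywiseMeasurable

section Filtration

variable {Ω : Type*} {N n : ℕ} {ni : Fin N → ℕ}
    {H : ℕ → ∀ i : Fin N, Ω → Matrix (Fin (ni i)) (Fin n) ℝ}
    {v : ℕ → Ω → ∀ i : Fin N, Fin (ni i) → ℝ}
    {A : ℕ → Ω → Matrix (Fin N) (Fin N) ℝ}
    {lam : ℕ → Fin N → Fin N → Ω → ℕ}

lemma sigBeforeD_mono : Monotone (sigBeforeD H v A lam) := fun _ _ hkl =>
  iSup_mono fun _ => iSup_mono' fun hs => ⟨lt_of_lt_of_le hs hkl, le_rfl⟩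

lemma sigBeforeD_le [mΩ : MeasurableSpace Ω]
    (hHmeas : ∀ k, Measurable (fun ω (i : Fin N) (p : Fin (ni i)) (c : Fin n) => H k i ω p c))
    (hvmeas : ∀ k, Measurable (v k))
    (hAmeas : ∀ k, Measurable (fun ω (i j : Fin N) => A k ω i j))
    (hlammeas : ∀ k, Measurable (fun ω (j i : Fin N) => lam k j i ω)) (k : ℕ) :
    sigBeforeD H v A lam k ≤ mΩ :=
  iSup_le fun s => iSup_le fun _ => sup_le (sup_le (sup_le (hHmeas s).comap_le
    (hvmeas s).comap_le) (hAmeas s).comap_le) (hlammeas s).comap_le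

lemma comap_sup_le_sigBeforeD (k : ℕ) :
    MeasurableSpace.comap
        (fun ω (i : Fin N) (p : Fin (ni i)) (c : Fin n) => H k i ω p c) inferInstance
      ⊔ MeasurableSpace.comap (v k) inferInstance
      ⊔ MeasurableSpace.comap (fun ω (i j : Fin N) => A k ω i j) inferInstance
      ⊔ MeasurableSpace.comap (fun ω (j i : Fin N) => lam k j i ω) inferInstance ≤
    sigBeforeD H v A lam (k + 1) :=
  le_iSup₂_of_le (f := fun s (_ : s < k + 1) => _) k (Nat.lt_succ_self k) le_rfl

lemma measurable_adjacency (k : ℕ) (i j : Fin N) :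
    Measurable[sigBeforeD H v A lam (k + 1)] fun ω => A k ω i j := by
  have h1 : Measurable[sigBeforeD H v A lam (k + 1)] fun ω (i j : Fin N) => A k ω i j :=
    measurable_iff_comap_le.2 (le_trans (le_sup_of_le_left le_sup_right) (comap_sup_le_sigBeforeD k))
  exact (measurable_pi_apply j).comp ((measurable_pi_apply i).comp h1)

lemma measurable_delay (k : ℕ) (j i : Fin N) :
    Measurable[sigBeforeD H v A lam (k + 1)] fun ω => lam k j i ω := by
  have h1 : Measurable[sigBeforeD H v A lam (k + 1)] fun ω (j i : Fin N) => lam k j i ω :=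
    measurable_iff_comap_le.2 (le_trans le_sup_right (comap_sup_le_sigBeforeD k))
  exact (measurable_pi_apply i).comp ((measurable_pi_apply j).comp h1)

lemma measurable_observation (k : ℕ) (i : Fin N) (p : Fin (ni i)) (c : Fin n) :
    Measurable[sigBeforeD H v A lam (k + 1)] fun ω => H k i ω p c := by
  have h1 : Measurable[sigBeforeD H v A lam (k + 1)]
      fun ω (i : Fin N) (p : Fin (ni i)) (c : Fin n) => H k i ω p c :=
    measurable_iff_comap_le.2 (le_trans (le_sup_of_le_left (le_sup_of_le_left le_sup_left))
      (comap_sup_le_sigBeforeD k))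
  exact (measurable_pi_apply c).comp ((measurable_pi_apply p).comp ((measurable_pi_apply i).comp h1))

lemma entrywiseMeasurable_degMat (k : ℕ) :
    EntrywiseMeasurable (sigBeforeD H v A lam (k + 1)) fun ω => degMat (A k ω) := by
  intro i j
  by_cases hij : i = j
  · subst hij
    simp only [degMat, Matrix.diagonal_apply_eq]
    exact Finset.measurable_fun_sum _ fun t _ => measurable_adjacency k i t
  · simp only [degMat, Matrix.diagonal_apply_ne _ hij]
    exact measurable_const

lemma entrywiseMeasurable_blockHtH (k : ℕ) :
    EntrywiseMeasurable (sigBeforeD H v A lam (k + 1))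
      fun ω => blockHtH (fun i => H k i ω) := by
  intro i j
  simp only [blockHtH, Matrix.of_apply]
  split_ifs
  · have h1 : EntrywiseMeasurable (sigBeforeD H v A lam (k + 1)) fun ω => H k i.1 ω :=
      measurable_observation k i.1
    exact (h1.transpose.mul h1) i.2 j.2
  · exact measurable_const

lemma entrywiseMeasurable_delayAdj (k s : ℕ) :
    EntrywiseMeasurable (sigBeforeD H v A lam (k + 1))
      fun ω => delayAdj n (A k ω) (fun j i => lam k j i ω) s := by
  refine EntrywiseMeasurable.kronecker_one fun i j => ?_
  simp only [Matrix.hadamard_apply, delayMat, Matrix.of_apply]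
  refine (measurable_adjacency k i j).mul (Measurable.ite ?_ measurable_const measurable_const)
  exact measurable_delay k j i (measurableSet_singleton s)

variable {d : ℕ} {a b : ℕ → ℝ} {F : ℤ → Ω → Matrix (Fin N × Fin n) (Fin N × Fin n) ℝ}

lemma entrywiseMeasurable_delay_recursion
    (hFinit : ∀ k : ℤ, -(d : ℤ) ≤ k → k ≤ -1 → ∀ ω, F k ω = 1)
    (hFrec : ∀ (k : ℕ) (ω : Ω), F k ω = 1 -
      (b k • (degMat (A k ω) ⊗ₖ (1 : Matrix (Fin n) (Fin n) ℝ))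
        + a k • blockHtH (fun i => H k i ω)
        - b k • ∑ q ∈ Finset.range (d+1),
            delayAdj n (A k ω) (fun j i => lam k j i ω) q *
              (phiProdZ (fun t => F t ω) ((k:ℤ) - 1) ((k:ℤ) - q))⁻¹)) (k : ℕ) :
    EntrywiseMeasurable (sigBeforeD H v A lam (k + 1)) (F k) ∧
      ∀ s ∈ Finset.range (d + 1), EntrywiseMeasurable (sigBeforeD H v A lam k)
        fun ω => (phiProdZ (fun t => F t ω) ((k:ℤ) - 1) ((k:ℤ) - s))⁻¹ := by
  induction k using Nat.strong_induction_on with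
  | _ k ih =>
    have hprev : ∀ t : ℕ, t < d →
        EntrywiseMeasurable (sigBeforeD H v A lam k) (F ((k : ℤ) - 1 - t)) := by
      intro t ht
      rcases Nat.lt_or_ge t k with htk | htk
      · obtain ⟨l, hl⟩ : ∃ l : ℕ, (k : ℤ) - 1 - t = l := ⟨k - 1 - t, by omega⟩
        rw [hl]
        exact (ih l (by omega)).1.mono (sigBeforeD_mono (by omega))
      · rw [show F ((k : ℤ) - 1 - t) = fun _ => 1 from
          funext fun ω => hFinit _ (by omega) (by omega) ω]
        exact EntrywiseMeasurable.const _
    have hinv : ∀ s ∈ Finset.range (d + 1), EntrywiseMeasurable (sigBeforeD H v A lam k)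
        fun ω => (phiProdZ (fun t => F t ω) ((k:ℤ) - 1) ((k:ℤ) - s))⁻¹ := by
      intro s hs
      have hs' := Finset.mem_range.1 hs
      have h1 := EntrywiseMeasurable.phiProdZ (F := F) (j := (k : ℤ) - 1) (l := s)
        fun t ht => hprev t (by omega)
      rw [sub_add_cancel] at h1
      exact h1.inv
    refine ⟨?_, hinv⟩
    rw [show F k = _ from funext (hFrec k)]
    refine (EntrywiseMeasurable.const 1).sub (EntrywiseMeasurable.sub (.add ?_ ?_)
      (.const_smul (.sum fun s hs => .mul ?_ ?_) _))
    · exact (entrywiseMeasurable_degMat k).kronecker_one.const_smul _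
    · exact (entrywiseMeasurable_blockHtH k).const_smul _
    · exact entrywiseMeasurable_delayAdj k s
    · exact (hinv s hs).mono (sigBeforeD_mono (Nat.le_succ k))

end Filtration

end EntrywiseMeasurable

section QuadraticForm

open scoped Matrix.Norms.L2Operator

variable {Ω p : Type*} [Fintype p]

lemma dotProduct_mulVec_eq_sum (A : Matrix p p ℝ) (y : p → ℝ) :
    y ⬝ᵥ A *ᵥ y = ∑ i, ∑ j, y i * y j * A i j := by
  simp only [dotProduct, Matrix.mulVec, Finset.mul_sum]
  exact Finset.sum_congr rfl fun i _ => Finset.sum_congr rfl fun j _ => by ring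

lemma dotProduct_add_transpose_mulVec (A : Matrix p p ℝ) (y : p → ℝ) :
    y ⬝ᵥ (A + Aᵀ) *ᵥ y = 2 * (y ⬝ᵥ A *ᵥ y) := by
  rw [Matrix.add_mulVec, dotProduct_add, Matrix.mulVec_transpose, ← dotProduct_comm (y ᵥ* A),
    ← Matrix.dotProduct_mulVec]
  ring

lemma integrable_and_integral_quadForm_cexpM {m : MeasurableSpace Ω}
    [mΩ : MeasurableSpace Ω] {μ : Measure Ω} [IsProbabilityMeasure μ] (hm : m ≤ mΩ)
    {y : Ω → p → ℝ} (hy : ∀ i, Measurable[m] fun ω => y ω i) {C : ℝ}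
    (hC : ∀ᵐ ω ∂μ, ∀ i, |y ω i| ≤ C) {Q : Ω → Matrix p p ℝ}
    (hQ : ∀ i j, Integrable (fun ω => Q ω i j) μ) :
    Integrable (fun ω => y ω ⬝ᵥ Q ω *ᵥ y ω) μ ∧
    Integrable (fun ω => y ω ⬝ᵥ cexpM μ m Q ω *ᵥ y ω) μ ∧
      ∫ ω, y ω ⬝ᵥ cexpM μ m Q ω *ᵥ y ω ∂μ = ∫ ω, y ω ⬝ᵥ Q ω *ᵥ y ω ∂μ := by
  simp only [dotProduct_mulVec_eq_sum]
  have hyy : ∀ i j, StronglyMeasurable[m] fun ω => y ω i * y ω j := fun i j =>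
    ((hy i).mul (hy j)).stronglyMeasurable
  have hyyC : ∀ i j, ∀ᵐ ω ∂μ, ‖y ω i * y ω j‖ ≤ C * C := by
    intro i j
    filter_upwards [hC] with ω hω
    rw [Real.norm_eq_abs, abs_mul]
    exact mul_le_mul (hω i) (hω j) (abs_nonneg _) ((abs_nonneg _).trans (hω i))
  have hint : ∀ i j (f : Ω → ℝ), Integrable f μ →
      Integrable (fun ω => y ω i * y ω j * f ω) μ := fun i j f hf =>
    hf.bdd_mul ((hyy i j).mono hm).aestronglyMeasurable (hyyC i j)
  have hQc : ∀ i j, Integrable (fun ω => cexpM μ m Q ω i j) μ := fun i j => integrable_condExp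
  refine ⟨integrable_finsetSum _ fun i _ => integrable_finsetSum _ fun j _ =>
      hint i j _ (hQ i j),
    integrable_finsetSum _ fun i _ => integrable_finsetSum _ fun j _ => hint i j _ (hQc i j), ?_⟩
  rw [integral_finsetSum _ fun i _ => integrable_finsetSum _ fun j _ => hint i j _ (hQc i j),
    integral_finsetSum _ fun i _ => integrable_finsetSum _ fun j _ => hint i j _ (hQ i j)]
  refine Finset.sum_congr rfl fun i _ => ?_
  rw [integral_finsetSum _ fun j _ => hint i j _ (hQc i j),
    integral_finsetSum _ fun j _ => hint i j _ (hQ i j)]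
  refine Finset.sum_congr rfl fun j _ => ?_
  have h1 := condExp_mul_of_stronglyMeasurable_left (hyy i j) (hint i j _ (hQ i j)) (hQ i j)
  have h2 := integral_condExp (μ := μ) (f := (fun ω => y ω i * y ω j) * fun ω => Q ω i j) hm
  exact (integral_congr_ae h1).symm.trans h2

variable [DecidableEq p]

lemma abs_dotProduct_mulVec_le (A : Matrix p p ℝ) (y : p → ℝ) :
    |y ⬝ᵥ A *ᵥ y| ≤ ‖A‖ * ∑ i, y i ^ 2 := by
  have h1 := abs_real_inner_le_norm (WithLp.toLp 2 y) (WithLp.toLp 2 (A *ᵥ y))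
  have h2 := Matrix.l2_opNorm_mulVec A (WithLp.toLp 2 y)
  have h3 : inner ℝ (WithLp.toLp 2 y) (WithLp.toLp 2 (A *ᵥ y)) = y ⬝ᵥ A *ᵥ y := by
    rw [EuclideanSpace.inner_toLp_toLp, star_trivial, dotProduct_comm]
  have h4 : ‖WithLp.toLp 2 y‖ ^ 2 = ∑ i, y i ^ 2 := EuclideanSpace.real_norm_sq_eq _
  rw [h3] at h1
  calc |y ⬝ᵥ A *ᵥ y| ≤ ‖WithLp.toLp 2 y‖ * (‖A‖ * ‖WithLp.toLp 2 y‖) :=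
        h1.trans (mul_le_mul_of_nonneg_left h2 (norm_nonneg _))
    _ = ‖A‖ * ∑ i, y i ^ 2 := by rw [← h4]; ring

lemma sum_sq_le_of_iterate_sub_mulVec {G : ℕ → Matrix p p ℝ} {y : ℕ → p → ℝ} {g : ℝ} {h : ℕ}
    (hg0 : 0 ≤ g) (hg : ∀ t < h, ‖G t‖ ≤ g) (hg1 : ∀ t < h, ‖G t‖ ≤ 1)
    (hy : ∀ t < h, y (t + 1) = y t - G t *ᵥ y t) :
    ∑ i, y h i ^ 2 ≤ ∑ i, y 0 i ^ 2 -
      ∑ t ∈ Finset.range h, y 0 ⬝ᵥ (G t + (G t)ᵀ) *ᵥ y 0 +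
      h * ((5 * h + 1) * 4 ^ h) * g ^ 2 * ∑ i, y 0 i ^ 2 := by
  have key := norm_sq_le_of_iterate_sub
    (G := fun t => Matrix.toEuclideanCLM (n := p) (𝕜 := ℝ) (G t))
    (y := fun t => WithLp.toLp 2 (y t)) (g := g) (h := h) hg0 hg hg1 (fun t ht => by
      rw [Matrix.toEuclideanCLM_toLp, hy t ht]; rfl)
  simp only [EuclideanSpace.real_norm_sq_eq, Matrix.toEuclideanCLM_toLp,
    EuclideanSpace.inner_toLp_toLp, star_trivial] at key
  simp only [dotProduct_add_transpose_mulVec]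
  simpa only [dotProduct_comm (y 0)] using key

variable [mΩ : MeasurableSpace Ω] {μ : Measure Ω} [IsProbabilityMeasure μ]

/-- Mean-square convergence to zero of `y (k + 1) = (1 - G k) y k` under a conditional
persistence of excitation condition along blocks of length `h`. -/
theorem tendsto_integral_sum_sq_of_excitation {𝓕 : ℕ → MeasurableSpace Ω} (h𝓕 : ∀ k, 𝓕 k ≤ mΩ)
    {G : ℕ → Ω → Matrix p p ℝ} (hG : ∀ k, EntrywiseMeasurable mΩ (G k))
    {a b : ℕ → ℝ} (hapos : ∀ k, 0 < a k) (hbpos : ∀ k, 0 < b k)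
    (haanti : Antitone a) (hbanti : Antitone b)
    {h : ℕ} (hh : 1 ≤ h) (haOshift : a =O[atTop] fun k => a (k + h))
    (hbo : (fun k => (b k) ^ 2) =o[atTop] a)
    (hadiv : Tendsto (fun K => ∑ k ∈ Finset.range K, a k) atTop atTop)
    {Cg : ℝ} (hCg : 0 ≤ Cg) (hGb : ∀ᵐ ω ∂μ, ∀ k, ‖G k ω‖ ≤ Cg * b k ∧ ‖G k ω‖ ≤ 1)
    {y : ℕ → Ω → p → ℝ} {x : p → ℝ} (hy0 : ∀ ω, y 0 ω = x)
    (hysucc : ∀ k ω, y (k + 1) ω = y k ω - G k ω *ᵥ y k ω)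
    (hymeas : ∀ k i, Measurable[𝓕 k] fun ω => y k ω i)
    {θ : ℝ} (hθ : 0 < θ)
    (hpe : ∀ᵐ ω ∂μ, ∀ (m : ℕ) (z : p → ℝ), θ * ∑ i, z i ^ 2 ≤
      z ⬝ᵥ (∑ k ∈ Finset.Ico (m * h) ((m + 1) * h),
        (a k)⁻¹ • cexpM μ (𝓕 (m * h)) (fun ω' => G k ω' + (G k ω')ᵀ) ω) *ᵥ z) :
    Tendsto (fun k => ∫ ω, ∑ i, y k ω i ^ 2 ∂μ) atTop (𝓝 0) := by
  have hstep : ∀ᵐ ω ∂μ, ∀ k, ∑ i, y (k + 1) ω i ^ 2 ≤ 4 * ∑ i, y k ω i ^ 2 := by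
    filter_upwards [hGb] with ω hω k
    have e : y (k + 1) ω = (1 - G k ω) *ᵥ y k ω := by
      rw [hysucc, Matrix.sub_mulVec, Matrix.one_mulVec]
    have h2 : ‖1 - G k ω‖ ≤ 2 := by
      linarith [norm_sub_le (1 : Matrix p p ℝ) (G k ω), l2_opNorm_one_le (p := p), (hω k).2]
    rw [e]
    refine (sum_sq_mulVec_le _ _).trans (mul_le_mul_of_nonneg_right ?_
      (Finset.sum_nonneg fun _ _ => sq_nonneg _))
    nlinarith [norm_nonneg (1 - G k ω)]
  have hiter : ∀ᵐ ω ∂μ, ∀ k l, ∑ i, y (k + l) ω i ^ 2 ≤ 4 ^ l * ∑ i, y k ω i ^ 2 := by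
    filter_upwards [hstep] with ω hω k l
    induction l with
    | zero => simp
    | succ l ih =>
      rw [← add_assoc, pow_succ', mul_assoc]
      exact (hω (k + l)).trans (mul_le_mul_of_nonneg_left ih (by norm_num))
  have hsq : ∀ᵐ ω ∂μ, ∀ k, ∑ i, y k ω i ^ 2 ≤ 4 ^ k * ∑ i, x i ^ 2 := by
    filter_upwards [hiter] with ω hω k
    simpa [hy0] using hω 0 k
  have hyint : ∀ k, Integrable (fun ω => ∑ i, y k ω i ^ 2) μ := by
    intro k
    refine Integrable.of_bound (Finset.measurable_fun_sum _ fun i _ =>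
      ((hymeas k i).mono (h𝓕 k) le_rfl).pow_const 2).aestronglyMeasurable
      (4 ^ k * ∑ i, x i ^ 2) ?_
    filter_upwards [hsq] with ω hω
    rw [Real.norm_of_nonneg (Finset.sum_nonneg fun _ _ => sq_nonneg _)]
    exact hω k
  have hybd : ∀ k, ∀ᵐ ω ∂μ, ∀ i, |y k ω i| ≤ Real.sqrt (4 ^ k * ∑ i, x i ^ 2) := by
    intro k
    filter_upwards [hsq] with ω hω i
    refine Real.abs_le_sqrt (le_trans ?_ (hω k))
    exact Finset.single_le_sum (f := fun i => y k ω i ^ 2) (fun _ _ => sq_nonneg _)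
      (Finset.mem_univ i)
  have hQint : ∀ k i j, Integrable (fun ω => (G k ω + (G k ω)ᵀ) i j) μ := by
    intro k i j
    have hi := fun i j => (hG k).integrable_of_norm_le (μ := μ) (C := 1)
      (by filter_upwards [hGb] with ω hω using (hω k).2) i j
    exact (hi i j).add (hi j i)
  set u : ℕ → ℝ := fun k => ∫ ω, ∑ i, y k ω i ^ 2 ∂μ with hu
  have hu0 : ∀ k, 0 ≤ u k := fun k => integral_nonneg fun ω =>
    Finset.sum_nonneg fun _ _ => sq_nonneg _
  set K : ℝ := h * ((5 * h + 1) * 4 ^ h) with hK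
  obtain ⟨C, hC0, m₀, hblock⟩ := exists_block_contraction hapos haanti hh haOshift hbo hθ
    (G := 2 * Cg) (K := K * Cg ^ 2) (by positivity) (by positivity)
  have hsub : Tendsto (fun m => u (m * h)) atTop (𝓝 0) := by
    refine tendsto_zero_of_le_one_sub_add (α := fun m => a (m * h)) (c := θ / 2) (C := C)
      (s := fun m => Real.sqrt (a (m * h))) (by positivity) hC0
      (fun m => hu0 _) (fun m => Real.sqrt_nonneg _) m₀ (fun m hm => ?_)
      (tendsto_sum_comp_mul_atTop haanti hadiv hh)
    have hquad := fun k => integrable_and_integral_quadForm_cexpM (h𝓕 (m * h)) (hymeas (m * h))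
      (hybd (m * h)) (hQint k)
    set g : ℕ → ℝ := fun k =>
      ∫ ω, y (m * h) ω ⬝ᵥ (G k ω + (G k ω)ᵀ) *ᵥ y (m * h) ω ∂μ with hg
    have hsucc : (m + 1) * h = m * h + h := by ring
    refine le_trans ?_ (hblock m hm g (u (m * h)) (hu0 _) (fun k _ => ?_) ?_)
    · have hpt : ∀ᵐ ω ∂μ, ∑ i, y ((m + 1) * h) ω i ^ 2 ≤ ∑ i, y (m * h) ω i ^ 2 -
          ∑ k ∈ Finset.Ico (m * h) ((m + 1) * h),
            y (m * h) ω ⬝ᵥ (G k ω + (G k ω)ᵀ) *ᵥ y (m * h) ω +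
          K * Cg ^ 2 * b (m * h) ^ 2 * ∑ i, y (m * h) ω i ^ 2 := by
        filter_upwards [hGb] with ω hω
        have h1 := sum_sq_le_of_iterate_sub_mulVec (G := fun t => G (m * h + t) ω)
          (y := fun t => y (m * h + t) ω) (g := Cg * b (m * h)) (h := h)
          (mul_nonneg hCg (hbpos _).le)
          (fun t _ => (hω _).1.trans (mul_le_mul_of_nonneg_left
            (hbanti (Nat.le_add_right _ _)) hCg))
          (fun t _ => (hω _).2) (fun t _ => hysucc _ _)
        rw [hsucc, Finset.sum_Ico_eq_sum_range, Nat.add_sub_cancel_left]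
        simp only [add_zero] at h1
        refine h1.trans (le_of_eq ?_)
        rw [mul_pow, ← hK]
        ring
      have hI1 : Integrable (fun ω => ∑ k ∈ Finset.Ico (m * h) ((m + 1) * h),
            y (m * h) ω ⬝ᵥ (G k ω + (G k ω)ᵀ) *ᵥ y (m * h) ω) μ :=
        integrable_finsetSum _ fun k _ => (hquad k).1
      have hI2 := (hyint (m * h)).const_mul (K * Cg ^ 2 * b (m * h) ^ 2)
      have h2 := integral_mono_ae (hyint _) (((hyint _).sub hI1).add hI2) hpt
      refine h2.trans (le_of_eq ?_)
      have h3 := integral_add ((hyint (m * h)).sub hI1) hI2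
      have h4 := integral_sub (hyint (m * h)) hI1
      simp only [Pi.sub_apply, Pi.add_apply] at h3 h4 ⊢
      rw [h3, h4, integral_const_mul, integral_finsetSum _ fun k _ => (hquad k).1]
    · have hI := (hyint (m * h)).const_mul (2 * Cg * b k)
      calc |g k| ≤ ∫ ω, |y (m * h) ω ⬝ᵥ (G k ω + (G k ω)ᵀ) *ᵥ y (m * h) ω| ∂μ :=
            abs_integral_le_integral_abs
        _ ≤ ∫ ω, 2 * Cg * b k * ∑ i, y (m * h) ω i ^ 2 ∂μ := by
            refine integral_mono_ae (hquad k).1.abs hI ?_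
            filter_upwards [hGb] with ω hω
            rw [dotProduct_add_transpose_mulVec, abs_mul, abs_two, mul_assoc, mul_assoc,
              ← mul_assoc Cg]
            refine mul_le_mul_of_nonneg_left ((abs_dotProduct_mulVec_le _ _).trans ?_) zero_le_two
            exact mul_le_mul_of_nonneg_right (hω k).1 (Finset.sum_nonneg fun _ _ => sq_nonneg _)
        _ = 2 * Cg * b k * u (m * h) := integral_const_mul _ _
    · have hI := fun k => ((hquad k).2.1.const_mul (a k)⁻¹)
      calc θ * u (m * h) = ∫ ω, θ * ∑ i, y (m * h) ω i ^ 2 ∂μ := (integral_const_mul _ _).symm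
        _ ≤ ∫ ω, ∑ k ∈ Finset.Ico (m * h) ((m + 1) * h), (a k)⁻¹ *
              (y (m * h) ω ⬝ᵥ cexpM μ (𝓕 (m * h)) (fun ω' => G k ω' + (G k ω')ᵀ) ω *ᵥ
                y (m * h) ω) ∂μ := by
            refine integral_mono_ae ((hyint _).const_mul θ)
              (integrable_finsetSum _ fun k _ => hI k) ?_
            filter_upwards [hpe] with ω hω
            refine (hω m (y (m * h) ω)).trans (le_of_eq ?_)
            rw [Matrix.sum_mulVec, dotProduct_sum]
            refine Finset.sum_congr rfl fun k _ => ?_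
            rw [Matrix.smul_mulVec, dotProduct_smul, smul_eq_mul]
        _ = ∑ k ∈ Finset.Ico (m * h) ((m + 1) * h), (a k)⁻¹ * g k := by
            rw [integral_finsetSum _ fun k _ => hI k]
            refine Finset.sum_congr rfl fun k _ => ?_
            rw [integral_const_mul, (hquad k).2.2]
  have hdiv : Tendsto (fun k : ℕ => k / h) atTop atTop :=
    Nat.tendsto_div_const_atTop (by omega)
  have hlim := ((hsub.comp hdiv).const_mul ((4 : ℝ) ^ h))
  rw [mul_zero] at hlim
  refine squeeze_zero hu0 (fun k => ?_) hlim
  have hk : k / h * h + k % h = k := by rw [mul_comm]; exact Nat.div_add_mod k h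
  calc u k ≤ ∫ ω, 4 ^ h * ∑ i, y (k / h * h) ω i ^ 2 ∂μ := by
        refine integral_mono_ae (hyint k) ((hyint _).const_mul _) ?_
        filter_upwards [hiter] with ω hω
        have h1 := hω (k / h * h) (k % h)
        rw [hk] at h1
        refine h1.trans (mul_le_mul_of_nonneg_right (pow_le_pow_right₀ (by norm_num)
          (Nat.mod_lt _ hh).le) (Finset.sum_nonneg fun _ _ => sq_nonneg _))
    _ = 4 ^ h * u (k / h * h) := integral_const_mul _ _

end QuadraticForm

section ConditionalExcitation

open scoped Matrix.Norms.L2Operator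

lemma sum_delayAdj {N n d : ℕ} (A : Matrix (Fin N) (Fin N) ℝ) {lam : Fin N → Fin N → ℕ}
    (hlam : ∀ j i, lam j i ≤ d) :
    ∑ s ∈ Finset.range (d + 1), delayAdj n A lam s =
      A ⊗ₖ (1 : Matrix (Fin n) (Fin n) ℝ) := by
  ext i j
  simp only [Matrix.sum_apply, delayAdj, Matrix.kroneckerMap_apply, Matrix.hadamard_apply,
    delayMat, Matrix.of_apply, ← Finset.sum_mul, ← Finset.mul_sum, Finset.sum_ite_eq,
    Finset.mem_range, if_pos (Nat.lt_succ_of_le (hlam j.1 i.1)), mul_one]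

lemma blockHtH_transpose {N n : ℕ} {ni : Fin N → ℕ}
    (H : ∀ i : Fin N, Matrix (Fin (ni i)) (Fin n) ℝ) : (blockHtH H)ᵀ = blockHtH H := by
  ext ⟨i, r⟩ ⟨j, s⟩
  simp only [Matrix.transpose_apply, blockHtH, Matrix.of_apply]
  by_cases hij : i = j
  · subst hij
    simp only [if_true, Matrix.mul_apply, Matrix.transpose_apply]
    exact Finset.sum_congr rfl fun _ _ => mul_comm _ _
  · rw [if_neg hij, if_neg (Ne.symm hij)]

/-- The symmetrized increment of the delay-elimination recursion, as `α` times the summand of the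
excitation matrix. -/
lemma increment_add_transpose_eq {N n d : ℕ} {ni : Fin N → ℕ}
    (H : ∀ i : Fin N, Matrix (Fin (ni i)) (Fin n) ℝ) (A : Matrix (Fin N) (Fin N) ℝ)
    {lam : Fin N → Fin N → ℕ} (hlam : ∀ j i, lam j i ≤ d) {α β : ℝ} (hα : α ≠ 0)
    (W : ℕ → Matrix (Fin N × Fin n) (Fin N × Fin n) ℝ)
    {G : Matrix (Fin N × Fin n) (Fin N × Fin n) ℝ}
    (hG : G = β • (degMat A ⊗ₖ (1 : Matrix (Fin n) (Fin n) ℝ)) + α • blockHtH H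
      - β • ∑ s ∈ Finset.range (d + 1), delayAdj n A lam s * W s) :
    α⁻¹ • (G + Gᵀ) = (2 * (β / α)) • (symmLapl A ⊗ₖ (1 : Matrix (Fin n) (Fin n) ℝ))
      + (2 : ℝ) • blockHtH H
      - (β / α) • ∑ s ∈ Finset.range (d + 1), delayAdj n A lam s * (W s - 1)
      - (β / α) • ∑ s ∈ Finset.range (d + 1), (W s - 1)ᵀ * (delayAdj n A lam s)ᵀ := by
  have e1 : ∑ s ∈ Finset.range (d + 1), delayAdj n A lam s * (W s - 1) =
      ∑ s ∈ Finset.range (d + 1), delayAdj n A lam s * W s -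
        A ⊗ₖ (1 : Matrix (Fin n) (Fin n) ℝ) := by
    rw [← sum_delayAdj A hlam, ← Finset.sum_sub_distrib]
    exact Finset.sum_congr rfl fun s _ => by rw [Matrix.mul_sub, Matrix.mul_one]
  have e2 : ∑ s ∈ Finset.range (d + 1), (W s - 1)ᵀ * (delayAdj n A lam s)ᵀ =
      (∑ s ∈ Finset.range (d + 1), delayAdj n A lam s * (W s - 1))ᵀ := by
    rw [Matrix.transpose_sum]
    exact Finset.sum_congr rfl fun s _ => by rw [Matrix.transpose_mul]
  have e3 : (degMat A)ᵀ = degMat A := Matrix.diagonal_transpose _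
  rw [e2, e1, hG]
  set S := ∑ s ∈ Finset.range (d + 1), delayAdj n A lam s * W s
  ext i j
  have h1 := congrFun (congrFun (blockHtH_transpose H) i) j
  have h2 := congrFun (congrFun e3 i.1) j.1
  simp only [Matrix.transpose_apply] at h1 h2
  simp only [Matrix.smul_apply, Matrix.add_apply, Matrix.sub_apply, Matrix.transpose_apply,
    smul_eq_mul, Matrix.kroneckerMap_apply, symmLapl, lapl, h1, h2,
    show (1 : Matrix (Fin n) (Fin n) ℝ) j.2 i.2 = (1 : Matrix (Fin n) (Fin n) ℝ) i.2 j.2 by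
      simp only [Matrix.one_apply, eq_comm]]
  field_simp
  ring

lemma condExp_linear_combination {Ω : Type*} {m : MeasurableSpace Ω} [mΩ : MeasurableSpace Ω]
    {μ : Measure Ω} {f₁ f₂ : Ω → ℝ} {f₃ f₄ : ℕ → Ω → ℝ} {s : Finset ℕ}
    (h₁ : Integrable f₁ μ) (h₂ : Integrable f₂ μ) (h₃ : ∀ t ∈ s, Integrable (f₃ t) μ)
    (h₄ : ∀ t ∈ s, Integrable (f₄ t) μ) (c₁ c₂ c₃ : ℝ) :
    μ[c₁ • f₁ + c₂ • f₂ - c₃ • ∑ t ∈ s, f₃ t - c₃ • ∑ t ∈ s, f₄ t|m] =ᵐ[μ]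
      c₁ • μ[f₁|m] + c₂ • μ[f₂|m] - c₃ • ∑ t ∈ s, μ[f₃ t|m] - c₃ • ∑ t ∈ s, μ[f₄ t|m] := by
  have i₃ := integrable_finsetSum' s h₃
  have i₄ := integrable_finsetSum' s h₄
  refine (condExp_sub (((h₁.smul c₁).add (h₂.smul c₂)).sub (i₃.smul c₃)) (i₄.smul c₃) m).trans ?_
  refine EventuallyEq.sub ((condExp_sub ((h₁.smul c₁).add (h₂.smul c₂)) (i₃.smul c₃) m).trans ?_)
    ((condExp_smul c₃ _ m).trans ((condExp_finsetSum h₄ m).const_smul c₃))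
  refine EventuallyEq.sub ((condExp_add (h₁.smul c₁) (h₂.smul c₂) m).trans ?_)
    ((condExp_smul c₃ _ m).trans ((condExp_finsetSum h₃ m).const_smul c₃))
  exact (condExp_smul c₁ f₁ m).add (condExp_smul c₂ f₂ m)

lemma norm_le_one_add_of_norm_le {p : Type*} [Fintype p] [DecidableEq p] {W : Matrix p p ℝ}
    {c : ℝ} (hW : ‖W‖ ≤ c) : ‖W - 1‖ ≤ c + 1 :=
  (norm_sub_le _ _).trans (add_le_add hW l2_opNorm_one_le)

/-- The conditional summand of the excitation matrix is `α⁻¹` times the conditional expectation of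
the symmetrized increment. -/
lemma excitation_summand_ae_eq {Ω : Type*} {m : MeasurableSpace Ω} [mΩ : MeasurableSpace Ω]
    {μ : Measure Ω} [IsProbabilityMeasure μ] {N n d : ℕ} {ni : Fin N → ℕ}
    {H : ∀ i : Fin N, Ω → Matrix (Fin (ni i)) (Fin n) ℝ} {A : Ω → Matrix (Fin N) (Fin N) ℝ}
    {lam : Fin N → Fin N → Ω → ℕ} (hlam : ∀ j i ω, lam j i ω ≤ d)
    {α β : ℝ} (hα : α ≠ 0)
    {W : ℕ → Ω → Matrix (Fin N × Fin n) (Fin N × Fin n) ℝ}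
    {G : Ω → Matrix (Fin N × Fin n) (Fin N × Fin n) ℝ}
    (hG : ∀ ω, G ω = β • (degMat (A ω) ⊗ₖ (1 : Matrix (Fin n) (Fin n) ℝ))
      + α • blockHtH (fun i => H i ω)
      - β • ∑ s ∈ Finset.range (d + 1), delayAdj n (A ω) (fun j i => lam j i ω) s * W s ω)
    (hL : ∀ i j, Integrable (fun ω => symmLapl (A ω) i j) μ)
    (hHH : ∀ i j, Integrable (fun ω => blockHtH (fun i => H i ω) i j) μ)
    (hW : ∀ s ∈ Finset.range (d + 1), ∀ i j, Integrable
      (fun ω => (delayAdj n (A ω) (fun j i => lam j i ω) s * (W s ω - 1)) i j) μ) :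
    ∀ᵐ ω ∂μ, (2 * (β / α)) • (cexpM μ m (fun ω' => symmLapl (A ω')) ω
              ⊗ₖ (1 : Matrix (Fin n) (Fin n) ℝ))
          + (2:ℝ) • cexpM μ m (fun ω' => blockHtH (fun i => H i ω')) ω
          - (β / α) • ∑ s ∈ Finset.range (d+1),
              cexpM μ m (fun ω' => delayAdj n (A ω') (fun j i => lam j i ω') s * (W s ω' - 1)) ω
          - (β / α) • ∑ s ∈ Finset.range (d+1),
              cexpM μ m (fun ω' => (W s ω' - 1)ᵀ *
                (delayAdj n (A ω') (fun j i => lam j i ω') s)ᵀ) ω =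
      α⁻¹ • cexpM μ m (fun ω' => G ω' + (G ω')ᵀ) ω := by
  have hentry : ∀ i j, ∀ᵐ ω ∂μ,
      (2 * (β / α)) * (1 : Matrix (Fin n) (Fin n) ℝ) i.2 j.2 *
          (μ[(fun ω' => symmLapl (A ω') i.1 j.1)|m]) ω
        + 2 * (μ[(fun ω' => blockHtH (fun i => H i ω') i j)|m]) ω
        - (β / α) * ∑ s ∈ Finset.range (d+1), (μ[(fun ω' =>
            (delayAdj n (A ω') (fun j i => lam j i ω') s * (W s ω' - 1)) i j)|m]) ω
        - (β / α) * ∑ s ∈ Finset.range (d+1), (μ[(fun ω' =>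
            ((W s ω' - 1)ᵀ * (delayAdj n (A ω') (fun j i => lam j i ω') s)ᵀ :
              Matrix (Fin N × Fin n) (Fin N × Fin n) ℝ) i j)|m]) ω =
      α⁻¹ * (μ[(fun ω' => (G ω' + (G ω')ᵀ) i j)|m]) ω := by
    intro i j
    have hWT : ∀ s ∈ Finset.range (d + 1), Integrable (fun ω' =>
        ((W s ω' - 1)ᵀ * (delayAdj n (A ω') (fun j i => lam j i ω') s)ᵀ :
              Matrix (Fin N × Fin n) (Fin N × Fin n) ℝ) i j) μ := by
      intro s hs
      simp only [← Matrix.transpose_mul]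
      exact hW s hs j i
    have h1 := condExp_linear_combination (m := m) (hL i.1 j.1) (hHH i j) (fun s hs => hW s hs i j)
      hWT (2 * (β / α) * (1 : Matrix (Fin n) (Fin n) ℝ) i.2 j.2) 2 (β / α)
    have h2 := condExp_smul (μ := μ) α⁻¹ (fun ω' => (G ω' + (G ω')ᵀ) i j) m
    have h3 : α⁻¹ • (fun ω' => (G ω' + (G ω')ᵀ) i j) =
        (2 * (β / α) * (1 : Matrix (Fin n) (Fin n) ℝ) i.2 j.2) •
          (fun ω' => symmLapl (A ω') i.1 j.1)
        + (2 : ℝ) • (fun ω' => blockHtH (fun i => H i ω') i j)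
        - (β / α) • ∑ s ∈ Finset.range (d+1), (fun ω' =>
            (delayAdj n (A ω') (fun j i => lam j i ω') s * (W s ω' - 1)) i j)
        - (β / α) • ∑ s ∈ Finset.range (d+1), (fun ω' =>
            ((W s ω' - 1)ᵀ * (delayAdj n (A ω') (fun j i => lam j i ω') s)ᵀ :
              Matrix (Fin N × Fin n) (Fin N × Fin n) ℝ) i j) := by
      funext ω
      have h4 := congrFun (congrFun (increment_add_transpose_eq (fun i => H i ω) (A ω)
        (fun j i => hlam j i ω) hα (fun s => W s ω) (hG ω)) i) j
      simp only [Matrix.smul_apply, Matrix.add_apply, Matrix.sub_apply, Matrix.sum_apply,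
        smul_eq_mul, Matrix.kroneckerMap_apply] at h4
      simp only [Pi.add_apply, Pi.sub_apply, Pi.smul_apply, Finset.sum_apply, smul_eq_mul,
        Matrix.add_apply]
      rw [h4]
      ring
    rw [h3] at h2
    filter_upwards [h1, h2] with ω hω1 hω2
    rw [hω1] at hω2
    simpa only [Pi.add_apply, Pi.sub_apply, Pi.smul_apply, Finset.sum_apply, smul_eq_mul] using hω2
  filter_upwards [ae_all_iff.2 fun i => ae_all_iff.2 fun j => hentry i j] with ω hω
  ext i j
  simp only [Matrix.smul_apply, Matrix.add_apply, Matrix.sub_apply, Matrix.sum_apply,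
    smul_eq_mul, Matrix.kroneckerMap_apply, cexpM, Matrix.of_apply]
  have := hω i j
  simp only [Matrix.add_apply] at this
  rw [← this]
  ring

end ConditionalExcitation

section Conclusion

open scoped Matrix.Norms.L2Operator

lemma integrable_symmLapl {Ω : Type*} [MeasurableSpace Ω] {μ : Measure Ω} {N : ℕ}
    {A : Ω → Matrix (Fin N) (Fin N) ℝ} (hA : ∀ i j, Integrable (fun ω => A ω i j) μ)
    (i j : Fin N) : Integrable (fun ω => symmLapl (A ω) i j) μ := by
  have hdeg : ∀ i j, Integrable (fun ω => degMat (A ω) i j) μ := by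
    intro i j
    by_cases hij : i = j
    · simpa only [degMat, Matrix.diagonal_apply, hij, if_true] using
        integrable_finsetSum Finset.univ fun l _ => hA j l
    · simp only [degMat, Matrix.diagonal_apply, hij, if_false]
      exact integrable_zero _ _ _
  simp only [symmLapl, lapl, Matrix.smul_apply, Matrix.add_apply, Matrix.sub_apply,
    Matrix.transpose_apply]
  exact (((hdeg i j).sub (hA i j)).add ((hdeg j i).sub (hA j i))).smul (2 : ℝ)⁻¹

lemma abs_mul_transpose_apply_le {p : Type*} [Fintype p] (M : Matrix p p ℝ) (i j : p) :
    |(M * Mᵀ) i j| ≤ ∑ l, ∑ r, M r l ^ 2 := by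
  rw [Matrix.mul_apply]
  refine (Finset.abs_sum_le_sum_abs _ _).trans (Finset.sum_le_sum fun l _ => ?_)
  have h1 : ∀ r, M r l ^ 2 ≤ ∑ r, M r l ^ 2 := fun r =>
    Finset.single_le_sum (f := fun r => M r l ^ 2) (fun _ _ => sq_nonneg _) (Finset.mem_univ r)
  rw [Matrix.transpose_apply, abs_le]
  constructor <;> nlinarith [h1 i, h1 j, sq_nonneg (M i l + M j l), sq_nonneg (M i l - M j l)]

lemma tendsto_specNorm_expM_mul_transpose {Ω p : Type*} [MeasurableSpace Ω] {μ : Measure Ω}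
    [Fintype p] [DecidableEq p] {M : ℕ → Ω → Matrix p p ℝ}
    (hint : ∀ k i l, Integrable (fun ω => M k ω i l ^ 2) μ)
    (hM : ∀ l, Tendsto (fun k => ∫ ω, ∑ i, M k ω i l ^ 2 ∂μ) atTop (𝓝 0)) :
    Tendsto (fun k => specNorm (expM μ fun ω => M k ω * (M k ω)ᵀ)) atTop (𝓝 0) := by
  have hint' : ∀ k l, Integrable (fun ω => ∑ i, M k ω i l ^ 2) μ := fun k l =>
    integrable_finsetSum _ fun i _ => hint k i l
  have hentry : Tendsto (fun k => expM μ fun ω => M k ω * (M k ω)ᵀ) atTop (𝓝 0) := by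
    refine tendsto_pi_nhds.2 fun i => tendsto_pi_nhds.2 fun j => ?_
    have hsum := tendsto_finsetSum Finset.univ fun l _ => hM l
    rw [Finset.sum_const_zero] at hsum
    refine squeeze_zero_norm (fun k => ?_) hsum
    rw [← integral_finsetSum _ fun l _ => hint' k l]
    exact norm_integral_le_of_norm_le (integrable_finsetSum _ fun l _ => hint' k l)
      (ae_of_all _ fun ω => abs_mul_transpose_apply_le (M k ω) i j)
  simpa only [specNorm_eq_norm, norm_zero] using hentry.norm

lemma norm_phiProdZ_le_two_pow {p : Type*} [Fintype p] [DecidableEq p] {F : ℤ → Matrix p p ℝ}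
    (hF : ∀ k : ℕ, ‖1 - F k‖ ≤ 1) (k : ℕ) : ‖phiProdZ F k 0‖ ≤ 2 ^ (k + 1) := by
  have h2 : ∀ k : ℕ, ‖F k‖ ≤ 2 := fun k => by
    have h := norm_sub_le (1 : Matrix p p ℝ) (1 - F k)
    rw [sub_sub_cancel] at h
    linarith [hF k, l2_opNorm_one_le (p := p)]
  induction k with
  | zero =>
    rw [phiProdZ_natCast_zero, phiProdZ, if_neg (by simp), mul_one]
    simpa using h2 0
  | succ k ih =>
    rw [phiProdZ_natCast_zero, pow_succ', Nat.cast_succ, add_sub_cancel_right]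
    exact (norm_mul_le _ _).trans
      (mul_le_mul (by exact_mod_cast h2 (k + 1)) ih (norm_nonneg _) zero_le_two)

lemma norm_delayAdj_mul_sub_one_le {N n : ℕ} {A : Matrix (Fin N) (Fin N) ℝ} {β c : ℝ}
    (hβ : 0 ≤ β) (hA : ∀ i j, |A i j| ≤ β) (lam : Fin N → Fin N → ℕ) (s : ℕ)
    {W : Matrix (Fin N × Fin n) (Fin N × Fin n) ℝ} (hW : ‖W‖ ≤ c) :
    ‖delayAdj n A lam s * (W - 1)‖ ≤ N * Real.sqrt N * β * (c + 1) :=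
  (norm_mul_le _ _).trans (mul_le_mul (norm_delayAdj_le hβ hA lam s)
    (norm_le_one_add_of_norm_le hW) (norm_nonneg _) (by positivity))

end Conclusion

/-- **Lemma 9.**  Under Assumptions (A2.b), (A3.a), (A3.c) and
`inf_{m≥0} λ′_m^h ≥ θ > 0` a.s., the expectation of the random matrix products
`Φ_F(k,0)Φ_F(k,0)ᵀ` vanishes: `lim_{k→∞} ‖E[Φ_F(k,0)Φ_F(k,0)ᵀ]‖ = 0`. -/
theorem phiF_product_expectation_vanishes
    {Ω : Type*} [MeasurableSpace Ω] (μ : Measure Ω) [IsProbabilityMeasure μ]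
    (N n : ℕ) (hN : 1 ≤ N) (hn : 1 ≤ n) (d : ℕ) (hd : 1 ≤ d)
    (ni : Fin N → ℕ) (hni : ∀ i, 1 ≤ ni i ∧ ni i ≤ n)
    -- the random observation matrices, noises, adjacency matrices and delays
    (H : ℕ → ∀ i : Fin N, Ω → Matrix (Fin (ni i)) (Fin n) ℝ)
    (v : ℕ → Ω → ∀ i : Fin N, Fin (ni i) → ℝ)
    (A : ℕ → Ω → Matrix (Fin N) (Fin N) ℝ)
    (lam : ℕ → Fin N → Fin N → Ω → ℕ)
    (hHmeas : ∀ k, Measurable (fun ω (i : Fin N) (p : Fin (ni i)) (c : Fin n) => H k i ω p c))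
    (hvmeas : ∀ k, Measurable (v k))
    (hAmeas : ∀ k, Measurable (fun ω (i j : Fin N) => A k ω i j))
    (hlammeas : ∀ k, Measurable (fun ω (j i : Fin N) => lam k j i ω))
    (hAdiag : ∀ k ω i, A k ω i i = 0)
    (hlamrange : ∀ k j i ω, lam k j i ω ≤ d)
    (hlamdiag : ∀ k i, ∀ᵐ ω ∂μ, lam k i i ω = 0)
    -- the gain sequences
    (a b : ℕ → ℝ)
    -- (A2.b)
    (βa βH : ℝ) (hβa : 0 < βa) (hβH : 0 < βH)
    (hA2b : ∀ᵐ ω ∂μ, (∀ k i j, |A k ω i j| ≤ βa) ∧ (∀ k i, specNorm (H k i ω) ≤ βH))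
    -- (A3.a)
    (hapos : ∀ k, 0 < a k) (hbpos : ∀ k, 0 < b k)
    (haanti : Antitone a) (hbanti : Antitone b)
    (halim : Tendsto a atTop (𝓝 0)) (hblim : Tendsto b atTop (𝓝 0))
    (haOb : a =O[atTop] b)
    (haOshift : ∀ m : ℕ, 1 ≤ m → a =O[atTop] fun k => a (k + m))
    (hbo : (fun k => (b k)^2) =o[atTop] a)
    (hadiv : Tendsto (fun K => ∑ k ∈ Finset.range K, a k) atTop atTop)
    -- (A3.c)
    (Ca : ℝ) (hCa : ∀ k, a k ≤ Ca * b k)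
    (hA3c : ∃ B : ℝ, (∀ k, b k ≤ B) ∧ ∃ κ : ℝ, 0 < κ ∧ κ < 1 ∧
      B < min (κ / (2 * (N * βa + N * Real.sqrt N * βa + Ca * βH ^ 2)))
        ((1 - (1 - κ)⁻¹) * κ / (2 * N * Real.sqrt N * βa * (1 - (1 - κ) ^ (-(d + 1 : ℤ))))))
    -- the matrices F(k) defined by the delay-elimination recursion
    (F : ℤ → Ω → Matrix (Fin N × Fin n) (Fin N × Fin n) ℝ)
    (hFinit : ∀ k : ℤ, -(d:ℤ) ≤ k → k ≤ -1 → ∀ ω, F k ω = 1)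
    (hFrec : ∀ (k : ℕ) (ω : Ω), F k ω = 1 -
      (b k • (degMat (A k ω) ⊗ₖ (1 : Matrix (Fin n) (Fin n) ℝ))
        + a k • blockHtH (fun i => H k i ω)
        - b k • ∑ q ∈ Finset.range (d+1),
            delayAdj n (A k ω) (fun j i => lam k j i ω) q *
              (phiProdZ (fun t => F t ω) ((k:ℤ) - 1) ((k:ℤ) - q))⁻¹))
    -- the persistence of excitation condition  inf_{m≥0} λ′_m^h ≥ θ > 0  a.s.
    (h : ℕ) (hh : 1 ≤ h) (θ : ℝ) (hθ : 0 < θ)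
    (hpe : ∀ᵐ ω ∂μ, ∀ m : ℕ,
      θ ≤ lambdaMin (∑ k ∈ Finset.Ico (m*h) ((m+1)*h),
        ((2 * (b k / a k)) •
            (cexpM μ (sigBeforeD H v A lam (m*h)) (fun ω' => symmLapl (A k ω')) ω
              ⊗ₖ (1 : Matrix (Fin n) (Fin n) ℝ))
          + (2:ℝ) • cexpM μ (sigBeforeD H v A lam (m*h))
              (fun ω' => blockHtH (fun i => H k i ω')) ω
          - (b k / a k) • ∑ q ∈ Finset.range (d+1),
              cexpM μ (sigBeforeD H v A lam (m*h))
                (fun ω' => delayAdj n (A k ω') (fun j i => lam k j i ω') q *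
                  ((phiProdZ (fun t => F t ω') ((k:ℤ) - 1) ((k:ℤ) - q))⁻¹ - 1)) ω
          - (b k / a k) • ∑ q ∈ Finset.range (d+1),
              cexpM μ (sigBeforeD H v A lam (m*h))
                (fun ω' => ((phiProdZ (fun t => F t ω') ((k:ℤ) - 1) ((k:ℤ) - q))⁻¹ - 1)ᵀ *
                  (delayAdj n (A k ω') (fun j i => lam k j i ω') q)ᵀ) ω))) :
    -- conclusion: the expectation of the products Φ_F(k,0)Φ_F(k,0)ᵀ vanishes in norm
    Tendsto (fun k : ℕ => specNorm (expM μ (fun ω =>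
        phiProdZ (fun t => F t ω) (k:ℤ) 0 * (phiProdZ (fun t => F t ω) (k:ℤ) 0)ᵀ)))
      atTop (𝓝 0) := by
  obtain ⟨B, hbB, κ, hκ0, hκ1, hB⟩ := hA3c
  set r : ℝ := (1 - κ)⁻¹
  set Cg : ℝ := N * Real.sqrt N * βa + Ca * βH ^ 2 +
    N * Real.sqrt N * βa * ∑ s ∈ Finset.range (d + 1), r ^ s
  have hr : 0 ≤ r := inv_nonneg.2 (by linarith)
  have hCa0 : 0 ≤ Ca := by
    by_contra hcon
    nlinarith [hCa 0, hapos 0, hbpos 0]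
  have hCg0 : 0 ≤ Cg := by positivity
  have hbound : ∀ᵐ ω ∂μ, ∀ k : ℕ, specNorm (1 - F k ω) ≤ b k * Cg ∧ specNorm (1 - F k ω) ≤ κ ∧
      ∀ s ∈ Finset.range (d + 1),
        specNorm (phiProdZ (fun t => F t ω) ((k : ℤ) - 1) ((k : ℤ) - s))⁻¹ ≤ r ^ s := by
    filter_upwards [hA2b] with ω hω
    exact norm_one_sub_delay_recursion_le (H := fun k i => H k i ω) (A := fun k => A k ω)
      (lam := fun k j i => lam k j i ω) (F := fun t => F t ω) hN hβa hβH hω.1 hω.2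
      hapos hbpos hCa hbB hκ0 hκ1 hB (fun k h1 h2 => hFinit k h1 h2 ω) (fun k => hFrec k ω)
  have h𝓕 := sigBeforeD_le hHmeas hvmeas hAmeas hlammeas
  have hFmeas := entrywiseMeasurable_delay_recursion (v := v) hFinit hFrec
  have hΦmeas : ∀ k : ℕ, EntrywiseMeasurable (sigBeforeD H v A lam k)
      fun ω => phiProdZ (fun t => F t ω) ((k : ℤ) - 1) 0 := by
    intro k
    have h1 := EntrywiseMeasurable.phiProdZ (m := sigBeforeD H v A lam k) (F := F)
      (j := (k : ℤ) - 1) (l := k) fun t ht => by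
        have h2 := (hFmeas (k - 1 - t)).1
        have e : ((k - 1 - t : ℕ) : ℤ) = (k : ℤ) - 1 - t := by omega
        rw [e] at h2
        exact h2.mono (sigBeforeD_mono (by omega))
    have e : (k : ℤ) - 1 + 1 - k = 0 := by ring
    rwa [e] at h1
  have hexc : ∀ᵐ ω ∂μ, ∀ m k : ℕ, _ :=
    ae_all_iff.2 fun m => ae_all_iff.2 fun k =>
      excitation_summand_ae_eq (m := sigBeforeD H v A lam (m * h)) (μ := μ) (d := d)
        (H := H k) (A := A k) (lam := lam k) (hlamrange k) (hapos k).ne' (β := b k)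
        (W := fun s ω => (phiProdZ (fun t => F t ω) ((k : ℤ) - 1) ((k : ℤ) - s))⁻¹)
        (G := fun ω => 1 - F k ω) (fun ω => by rw [hFrec k ω, sub_sub_cancel])
        (integrable_symmLapl fun i j => Integrable.of_bound
          ((measurable_adjacency (H := H) (v := v) (lam := lam) k i j).mono
            (h𝓕 (k + 1)) le_rfl).aestronglyMeasurable βa
          (hA2b.mono fun ω hω => hω.1 k i j))
        (((entrywiseMeasurable_blockHtH (v := v) (A := A) (lam := lam) k).mono
          (h𝓕 (k + 1))).integrable_of_norm_le
          (hA2b.mono fun ω hω => norm_blockHtH_le hβH.le _ (hω.2 k)))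
        (fun s hs => (((entrywiseMeasurable_delayAdj (H := H) (v := v) k s).mono
            (h𝓕 (k + 1))).mul ((((hFmeas k).2 s hs).mono (h𝓕 k)).sub
              (EntrywiseMeasurable.const 1))).integrable_of_norm_le
          (C := N * Real.sqrt N * βa * (r ^ s + 1)) (by
            filter_upwards [hA2b, hbound] with ω hω hω'
            exact norm_delayAdj_mul_sub_one_le hβa.le (hω.1 k) _ s ((hω' k).2.2 s hs)))
  have hcol : ∀ l, Tendsto (fun k : ℕ => ∫ ω, ∑ i,
      phiProdZ (fun t => F t ω) (k : ℤ) 0 i l ^ 2 ∂μ) atTop (𝓝 0) := by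
    intro l
    have hlim := tendsto_integral_sum_sq_of_excitation (μ := μ) h𝓕 (G := fun k ω => 1 - F k ω)
      (fun k => (EntrywiseMeasurable.const 1).sub ((hFmeas k).1.mono (h𝓕 (k + 1))))
      hapos hbpos haanti hbanti hh (haOshift h hh) hbo hadiv hCg0
      (by
        filter_upwards [hbound] with ω hω k
        exact ⟨(hω k).1.trans_eq (mul_comm _ _), (hω k).2.1.trans hκ1.le⟩)
      (y := fun k ω => phiProdZ (fun t => F t ω) ((k : ℤ) - 1) 0 *ᵥ Pi.single l 1)
      (x := Pi.single l 1)
      (fun ω => by rw [phiProdZ, if_neg (by simp), Matrix.one_mulVec])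
      (fun k ω => by
        rw [Nat.cast_succ, add_sub_cancel_right, phiProdZ_natCast_zero, ← Matrix.mulVec_mulVec,
          Matrix.sub_mulVec, Matrix.one_mulVec, sub_sub_cancel])
      (fun k i => by simpa only [Matrix.mulVec_single_one, Matrix.col_apply] using hΦmeas k i l)
      hθ (by
        filter_upwards [hpe, hexc] with ω hω hω' m z
        refine (mul_le_mul_of_nonneg_right (hω m)
          (Finset.sum_nonneg fun _ _ => sq_nonneg _)).trans ((lambdaMin_mul_le _ z).trans_eq ?_)
        rw [Finset.sum_congr rfl fun k _ => hω' m k])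
    simpa only [Function.comp_def, Nat.cast_succ, add_sub_cancel_right, Matrix.mulVec_single_one,
      Matrix.col_apply] using hlim.comp (tendsto_add_atTop_nat 1)
  refine tendsto_specNorm_expM_mul_transpose
    (M := fun k ω => phiProdZ (fun t => F t ω) (k : ℤ) 0) (fun k i l => ?_) hcol
  refine Integrable.of_bound (C := (2 ^ (k + 1)) ^ 2) (Measurable.aestronglyMeasurable ?_) ?_
  · have h1 := (hΦmeas (k + 1)).mono (h𝓕 (k + 1)) i l
    simp only [Nat.cast_succ, add_sub_cancel_right] at h1
    exact h1.pow_const 2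
  · filter_upwards [hbound] with ω hω
    rw [Real.norm_eq_abs, abs_pow]
    exact pow_le_pow_left₀ (abs_nonneg _) ((abs_entry_le_norm _ i l).trans
      (norm_phiProdZ_le_two_pow (F := fun t => F t ω) (fun k => (hω k).2.1.trans hκ1.le) k)) 2
end

section
/- Fix integers M ≥ 1 and d ≥ 1, real sequences a(k), b(k) (k ≥ 0), and M × M real matrices D(k), S(k), Ā(k,0),…,Ā(k,d) and vectors w(k) ∈ ℝ^M for k ≥ 0. Let F(k) (k ≥ −d) and C_1(k),…,C_d(k) (k ≥ 0) be M × M matrices with F(k) = I_M for −d ≤ k ≤ −1, satisfying for every k ≥ 0: F(k) + C_1(k) = I_M − b(k)D(k) − a(k)S(k) + b(k)Ā(k,0); C_q(k)F(k−q) − C_{q+1}(k) = −b(k)Ā(k,q) for 1 ≤ q ≤ d−1; and C_d(k)F(k−d) = −b(k)Ā(k,d). Suppose e : {−d, −d+1, …} → ℝ^M satisfies, for all k ≥ 0, e(k+1) = [I_M − b(k)D(k) − a(k)S(k)]e(k) + b(k)Σ_{q=0}^d Ā(k,q)e(k−q) + w(k). Define g(k) = e(k+1) − F(k)e(k) for k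 ≥ −d. Then for every k ≥ 0, g(k) = Σ_{q=1}^d C_q(k)g(k−q) + w(k). Consequently the delayed error system and the transformed system r(k+1) = F(k)r(k) + g(k), g(k) = Σ_{q=1}^d C_q(k)g(k−q) + w(k) are equivalent: if r(k) = e(k) for −d ≤ k ≤ −1 then r(k) = e(k) for all k ≥ 0. -/
open Matrix

/-- **Equivalence of the delayed error system and the transformed delay-free system.**
Given matrices `F(k)`, `C_q(k)` satisfying the delay-elimination identities, if `e`
satisfies the delayed error recursion and `g(k) = e(k+1) − F(k)e(k)`, then
`g(k) = Σ_{q=1}^d C_q(k) g(k−q) + w(k)` for all `k ≥ 0`; and any solution `r` of the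
transformed system `r(k+1) = F(k)r(k) + g(k)` agreeing with `e` on `−d ≤ k ≤ −1`
agrees with `e` for all `k ≥ 0`. -/
theorem delayed_system_equivalence
    (M d : ℕ) (hM : 1 ≤ M) (hd : 1 ≤ d)
    (a b : ℕ → ℝ)
    (D S : ℕ → Matrix (Fin M) (Fin M) ℝ)
    (Ab : ℕ → ℕ → Matrix (Fin M) (Fin M) ℝ)
    (w : ℕ → Fin M → ℝ)
    (F : ℤ → Matrix (Fin M) (Fin M) ℝ)
    (C : ℕ → ℕ → Matrix (Fin M) (Fin M) ℝ)  -- `C q k` is `C_q(k)` for `1 ≤ q ≤ d`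
    (hFinit : ∀ k : ℤ, -(d:ℤ) ≤ k → k ≤ -1 → F k = 1)
    (hEq0 : ∀ k : ℕ, F k + C 1 k = 1 - b k • D k - a k • S k + b k • Ab k 0)
    (hEqq : ∀ k : ℕ, ∀ q : ℕ, 1 ≤ q → q ≤ d - 1 →
      C q k * F ((k:ℤ) - q) - C (q+1) k = -(b k) • Ab k q)
    (hEqd : ∀ k : ℕ, C d k * F ((k:ℤ) - d) = -(b k) • Ab k d)
    (e : ℤ → Fin M → ℝ)
    (herec : ∀ k : ℕ, e ((k:ℤ)+1) =
      ((1 : Matrix (Fin M) (Fin M) ℝ) - b k • D k - a k • S k).mulVec (e (k:ℤ))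
        + (∑ q ∈ Finset.range (d+1), b k • (Ab k q).mulVec (e ((k:ℤ) - q)))
        + w k)
    (g : ℤ → Fin M → ℝ)
    (hg : ∀ k : ℤ, g k = e (k+1) - (F k).mulVec (e k)) :
    (∀ k : ℕ, g k = (∑ q ∈ Finset.Icc 1 d, (C q k).mulVec (g ((k:ℤ) - q))) + w k) ∧
    (∀ r : ℤ → Fin M → ℝ,
      (∀ k : ℤ, -(d:ℤ) ≤ k → r (k+1) = (F k).mulVec (r k) + g k) →
      (∀ k : ℤ, -(d:ℤ) ≤ k → k ≤ -1 → r k = e k) →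
      ∀ k : ℤ, 0 ≤ k → r k = e k) := by
  obtain ⟨m, rfl⟩ : ∃ m, d = m + 1 := ⟨d - 1, by omega⟩
  refine ⟨fun k => ?_, fun r hr hinit k hk => ?_⟩
  · have htele : ∀ n : ℕ, n ≤ m →
        (∑ q ∈ Finset.Icc 1 n, (C q k).mulVec (g ((k:ℤ) - q)))
          + (C (n+1) k).mulVec (e ((k:ℤ) - n)) + b k • (Ab k 0).mulVec (e (k:ℤ))
        = (C 1 k).mulVec (e (k:ℤ))
          + ∑ q ∈ Finset.range (n+1), b k • (Ab k q).mulVec (e ((k:ℤ) - q)) := by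
      intro n
      induction n with
      | zero => intro _; simp
      | succ n ih =>
        intro hn
        have hstep := congrArg (fun A => A.mulVec (e ((k:ℤ) - (n+1 : ℕ))))
          (hEqq k (n+1) (by omega) (by omega))
        simp only [sub_mulVec, ← mulVec_mulVec, neg_smul, neg_mulVec, smul_mulVec] at hstep
        have hshift : (k:ℤ) - (n+1 : ℕ) + 1 = k - n := by push_cast; ring
        rw [Finset.sum_Icc_succ_top (by omega), Finset.sum_range_succ, ← add_assoc,
          ← ih (by omega), hg, hshift, mulVec_sub]
        linear_combination -hstep
    have hlast := congrArg (fun A => A.mulVec (e ((k:ℤ) - (m+1 : ℕ)))) (hEqd k)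
    have hfirst := congrArg (fun A => A.mulVec (e (k:ℤ))) (hEq0 k)
    simp only [← mulVec_mulVec, neg_smul, neg_mulVec, smul_mulVec] at hlast
    simp only [add_mulVec _ (C 1 k), add_mulVec _ (b k • Ab k 0),
      smul_mulVec _ (Ab k 0)] at hfirst
    have hshift : (k:ℤ) - (m+1 : ℕ) + 1 = k - m := by push_cast; ring
    have hsum := htele m le_rfl
    rw [Finset.sum_Icc_succ_top (by omega), hg k, herec, Finset.sum_range_succ,
      hg ((k:ℤ) - (m+1 : ℕ)), hshift, mulVec_sub]
    linear_combination -hsum - hfirst + hlast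
  · have hagree : ∀ j : ℤ, -1 ≤ j → r j = e j := by
      intro j hj
      induction j, hj using Int.leInduction with
      | base => exact hinit (-1) (by push_cast; omega) le_rfl
      | succ j hj ih =>
        rw [hr j (by push_cast; omega), ih, hg]
        abel
    exact hagree k (by omega)
end

section
/- Let a : ℕ → (0, ∞) be a sequence that decreases monotonically to 0 with Σ_{k≥0} a(k) = ∞ and a(k) = O(a(k+m)) as k → ∞ for each fixed m ≥ 1. Let θ > 0 satisfy θ a(k) < 2 for all k, and let h be a positive integer. For i ≥ 0 write m̃_i = ⌈i/h⌉. Then lim_{M→∞} Σ_{i=0}^{Mh−1} a(i)² ∏_{s=m̃_{i+1}}^{M−1} (1 − (θ/2) a((s+1)h)) = 0, where an empty product equals 1. -/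
open Filter Topology

/-- A perturbed contraction `u (n + 1) = (1 - b n) * u n + c n` with `∑ b = ∞` and `c = o(b)`
converges to zero. -/
theorem tendsto_zero_of_recurrence {u b c : ℕ → ℝ} (hb0 : ∀ n, 0 ≤ b n) (hb1 : ∀ n, b n ≤ 1)
    (hb : Tendsto (fun n => ∑ k ∈ Finset.range n, b k) atTop atTop) (hc : c =o[atTop] b)
    (hu : ∀ n, u (n + 1) = (1 - b n) * u n + c n) : Tendsto u atTop (𝓝 0) := by
  rw [Metric.tendsto_atTop]
  intro ε hε
  obtain ⟨N, hN⟩ := eventually_atTop.1 (hc.bound (half_pos hε))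
  have bound : ∀ n, |u (N + n)| ≤
      ε / 2 + Real.exp (-∑ k ∈ Finset.range n, b (N + k)) * |u N| := by
    intro n
    induction n with
    | zero => simp; linarith
    | succ n ih =>
      have hcn : |c (N + n)| ≤ ε / 2 * b (N + n) := by
        simpa [abs_of_nonneg (hb0 _)] using hN (N + n) (by omega)
      have h1 : 0 ≤ 1 - b (N + n) := by linarith [hb1 (N + n)]
      have h2 : 1 - b (N + n) ≤ Real.exp (-b (N + n)) := by
        linarith [Real.add_one_le_exp (-b (N + n))]
      rw [← add_assoc, hu, Finset.sum_range_succ, neg_add, Real.exp_add]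
      set E := Real.exp (-∑ k ∈ Finset.range n, b (N + k))
      have hE : 0 ≤ E * |u N| := by positivity
      calc |(1 - b (N + n)) * u (N + n) + c (N + n)|
          ≤ (1 - b (N + n)) * |u (N + n)| + |c (N + n)| := by
            refine (abs_add_le _ _).trans ?_
            rw [abs_mul, abs_of_nonneg h1]
        _ ≤ (1 - b (N + n)) * (ε / 2 + E * |u N|) + ε / 2 * b (N + n) := by gcongr
        _ = ε / 2 + (1 - b (N + n)) * (E * |u N|) := by ring
        _ ≤ ε / 2 + Real.exp (-b (N + n)) * (E * |u N|) := by gcongr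
        _ = ε / 2 + E * Real.exp (-b (N + n)) * |u N| := by ring
  have hsum : Tendsto (fun n => ∑ k ∈ Finset.range n, b (N + k)) atTop atTop := by
    have h1 : Tendsto (fun n => ∑ k ∈ Finset.range (N + n), b k) atTop atTop :=
      hb.comp (tendsto_add_atTop_nat N |>.congr fun n => add_comm n N)
    refine (tendsto_atTop_add_const_left _ (-∑ k ∈ Finset.range N, b k) h1).congr fun n => ?_
    rw [Finset.sum_range_add]
    ring
  have hexp : Tendsto (fun n => Real.exp (-∑ k ∈ Finset.range n, b (N + k)) * |u N|)
      atTop (𝓝 0) := by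
    simpa using (Real.tendsto_exp_neg_atTop_nhds_zero.comp hsum).mul_const |u N|
  obtain ⟨K, hK⟩ := eventually_atTop.1 (hexp.eventually_lt_const (half_pos hε))
  refine ⟨N + K, fun n hn => ?_⟩
  obtain ⟨m, rfl⟩ := Nat.exists_eq_add_of_le (show N ≤ n by omega)
  rw [Real.dist_eq, sub_zero]
  linarith [bound m, hK m (by omega)]

/-- An antitone sequence with divergent series still has divergent series along the positive
multiples of `h`. -/
theorem Antitone.tendsto_sum_multiples_atTop {a : ℕ → ℝ} (ha : Antitone a)
    (hdiv : Tendsto (fun K => ∑ k ∈ Finset.range K, a k) atTop atTop) {h : ℕ} (hh : 1 ≤ h) :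
    Tendsto (fun M => ∑ s ∈ Finset.range M, a ((s + 1) * h)) atTop atTop := by
  have block : ∀ m, ∑ x ∈ Finset.range h, a (m + x) ≤ h * a m := fun m => by
    simpa using Finset.sum_le_card_nsmul (Finset.range h) (fun x => a (m + x)) (a m)
      fun x _ => ha (Nat.le_add_right m x)
  have bound : ∀ M, ∑ k ∈ Finset.range ((M + 1) * h), a k ≤
      h * a 0 + h * ∑ s ∈ Finset.range M, a ((s + 1) * h) := by
    intro M
    induction M with
    | zero => simpa using block 0
    | succ M ih =>
      rw [add_mul (M + 1) 1 h, one_mul, Finset.sum_range_add, Finset.sum_range_succ]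
      linarith [block ((M + 1) * h)]
  have hh' : (0 : ℝ) < h := by exact_mod_cast hh
  have hsub : Tendsto (fun M : ℕ => (M + 1) * h) atTop atTop :=
    tendsto_atTop_mono (fun M => (Nat.le_succ M).trans (Nat.le_mul_of_pos_right _ hh)) tendsto_id
  have h1 := tendsto_atTop_mono bound (hdiv.comp hsub)
  refine (tendsto_const_mul_atTop_of_pos hh').1 ?_
  simpa using tendsto_atTop_add_const_left _ (-(h * a 0)) h1

/-- **Key weighted-sum estimate.**
If `a` decreases monotonically to `0` with divergent series and `a(k) = O(a(k+m))` for
each fixed `m ≥ 1`, and `θ > 0` satisfies `θ a(k) < 2` for all `k`, then for every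
positive integer `h`, with `m̃_{i+1} = ⌈(i+1)/h⌉`,
`lim_{M→∞} Σ_{i=0}^{Mh−1} a(i)² ∏_{s=m̃_{i+1}}^{M−1} (1 − (θ/2)a((s+1)h)) = 0`. -/
theorem weighted_sum_tendsto_zero
    (a : ℕ → ℝ)
    (hapos : ∀ k, 0 < a k)
    (haanti : Antitone a)
    (halim : Tendsto a atTop (𝓝 0))
    (hadiv : Tendsto (fun K => ∑ k ∈ Finset.range K, a k) atTop atTop)
    (haOshift : ∀ m : ℕ, 1 ≤ m → (fun k => a k) =O[atTop] fun k => a (k + m))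
    (θ : ℝ) (hθ : 0 < θ) (hθ2 : ∀ k, θ * a k < 2)
    (h : ℕ) (hh : 1 ≤ h) :
    Tendsto (fun M => ∑ i ∈ Finset.range (M*h),
        (a i)^2 * ∏ s ∈ Finset.Ico ((i + h) / h) M, (1 - θ/2 * a ((s+1)*h)))
      atTop (𝓝 0) := by
  have hh' : 0 < h := hh
  refine tendsto_zero_of_recurrence (b := fun M => θ / 2 * a ((M + 1) * h))
    (c := fun M => ∑ x ∈ Finset.range h, a (M * h + x) ^ 2)
    (fun n => by have := hapos ((n + 1) * h); positivity)
    (fun n => by linarith [hθ2 ((n + 1) * h)]) ?_ ?_ fun M => ?_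
  · simp_rw [← Finset.mul_sum]
    exact (haanti.tendsto_sum_multiples_atTop hadiv hh).const_mul_atTop (half_pos hθ)
  · have hmul : Tendsto (fun M : ℕ => M * h) atTop atTop :=
      tendsto_atTop_mono (fun M => Nat.le_mul_of_pos_right M hh') tendsto_id
    have hO : (fun M => a (M * h)) =O[atTop] fun M => θ / 2 * a ((M + 1) * h) := by
      refine Asymptotics.IsBigO.const_mul_right (half_pos hθ).ne' ?_
      simpa only [Function.comp_def, add_mul, one_mul] using (haOshift h hh).comp_tendsto hmul
    have ho : (fun M => a (M * h)) =o[atTop] fun _ => (1 : ℝ) :=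
      (Asymptotics.isLittleO_one_iff ℝ).2 (halim.comp hmul)
    refine Asymptotics.IsLittleO.fun_sum fun x _ => ?_
    have hx : (fun M => a (M * h + x) ^ 2) =O[atTop] fun M => a (M * h) * a (M * h) := by
      refine Asymptotics.IsBigO.of_norm_le fun M => ?_
      have h0 := hapos (M * h + x)
      have h1 := haanti (Nat.le_add_right (M * h) x)
      rw [Real.norm_of_nonneg (by positivity)]
      nlinarith
    simpa using hx.trans_isLittleO (ho.mul_isBigO hO)
  · rw [show Finset.range ((M + 1) * h) = Finset.range (M * h + h) by rw [Nat.add_one_mul],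
      Finset.sum_range_add, Finset.mul_sum]
    congr 1
    · refine Finset.sum_congr rfl fun i hi => ?_
      have hi' : (i + h) / h ≤ M := by
        rw [Nat.add_div_right _ hh']
        exact Nat.div_lt_of_lt_mul (by rw [mul_comm]; exact Finset.mem_range.1 hi)
      rw [Finset.prod_Ico_succ_top hi']
      ring
    · refine Finset.sum_congr rfl fun x hx => ?_
      have hx' : (M * h + x + h) / h = M + 1 := by
        rw [Nat.add_div_right _ hh', mul_comm, Nat.mul_add_div hh',
          Nat.div_eq_of_lt (Finset.mem_range.1 hx), add_zero]
      simp [hx']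
end
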